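/- Let n ∈ ℕ, q ∈ (0,1], and let F be a real polynomial of degree ≤ n. Then F *_q^n G ∈ 𝓝_n(q) for every G ∈ 𝓝_n(q) if and only if F ∈ 𝓝̄_n(q). -/

import Mathlib

open Polynomial Filter

open scoped Classical

noncomputable section

/-- `R_n(q;z) = ∏_{j=1}^n (1 + q^{j-1} z)`, the generating polynomial of the
q-binomial coefficients. -/
def Rpoly (n : ℕ) (q : ℝ) : Polynomial ℝ :=
  ∏ j ∈ Finset.range n, (1 + Polynomial.C (q ^ j) * Polynomial.X)

/-- The q-binomial coefficient `C_k^n(q)`. -/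
def qBinom (n k : ℕ) (q : ℝ) : ℝ := (Rpoly n q).coeff k

/-- The weighted Hadamard product `F *_q^n G`: if `F = ∑ C_k^n(q) a_k z^k` and
`G = ∑ C_k^n(q) b_k z^k`, then `F *_q^n G = ∑ C_k^n(q) a_k b_k z^k`. -/
def qHadamard (n : ℕ) (q : ℝ) (F G : Polynomial ℝ) : Polynomial ℝ :=
  ∑ k ∈ Finset.range (n + 1),
    Polynomial.C (F.coeff k * G.coeff k / qBinom n k q) * Polynomial.X ^ k

/-- All zeros of the real polynomial `F` are real (it splits over `ℝ`). -/
def RealRooted (F : Polynomial ℝ) : Prop :=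
  F = 0 ∨ F.roots.card = F.natDegree

/-- All real roots of `F` are nonpositive. -/
def OnlyNonposRoots (F : Polynomial ℝ) : Prop := ∀ x ∈ F.roots, x ≤ 0

/-- The multiset `s` (of zeros, with multiplicity) is logarithmically q-separated. -/
def LogSep (q : ℝ) (s : Multiset ℝ) : Prop :=
  (∀ x ∈ s, x ≠ 0 → 2 ≤ s.count x → (1 : ℝ) ≤ q) ∧
  (∀ x ∈ s, ∀ y ∈ s, ((y < x ∧ x < 0) ∨ (0 < x ∧ x < y)) → x / y ≤ q)

/-- The multiset `s` (of zeros, with multiplicity) is strictly logarithmically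
q-separated. -/
def StrictLogSep (q : ℝ) (s : Multiset ℝ) : Prop :=
  (∀ x ∈ s, x ≠ 0 → 2 ≤ s.count x → (1 : ℝ) < q) ∧
  (∀ x ∈ s, ∀ y ∈ s, ((y < x ∧ x < 0) ∨ (0 < x ∧ x < y)) → x / y < q)

/-- The class `𝓡̄_n(q)`. -/
def memRbar (n : ℕ) (q : ℝ) (F : Polynomial ℝ) : Prop :=
  F.natDegree ≤ n ∧ RealRooted F ∧ LogSep q F.roots

/-- The class `𝓡_n(q)`. -/
def memR (n : ℕ) (q : ℝ) (F : Polynomial ℝ) : Prop :=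
  F.natDegree ≤ n ∧ RealRooted F ∧ StrictLogSep q F.roots

/-- The class `𝓝̄_n(q)`. -/
def memNbar (n : ℕ) (q : ℝ) (F : Polynomial ℝ) : Prop :=
  memRbar n q F ∧ OnlyNonposRoots F

/-- The class `𝓝_n(q)`. -/
def memN (n : ℕ) (q : ℝ) (F : Polynomial ℝ) : Prop :=
  memR n q F ∧ OnlyNonposRoots F

/-- `F ≼ G` : both have only real zeros and `F'G - FG' ≤ 0` on `ℝ`. -/
def Prec (F G : Polynomial ℝ) : Prop :=
  RealRooted F ∧ RealRooted G ∧
    ∀ x : ℝ, (Polynomial.derivative F * G - F * Polynomial.derivative G).eval x ≤ 0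

/-- `F ≺ G` : `F ≼ G` and no common zeros. -/
def PrecS (F G : Polynomial ℝ) : Prop :=
  Prec F G ∧ ∀ x : ℝ, ¬ (F.eval x = 0 ∧ G.eval x = 0)

/-- `F ≺₀ G` : `F ≼ G` and no common zeros except possibly at the origin. -/
def Prec0 (F G : Polynomial ℝ) : Prop :=
  Prec F G ∧ ∀ x : ℝ, x ≠ 0 → ¬ (F.eval x = 0 ∧ G.eval x = 0)

/-- `F ⋎ G` : `G ≼ zF`. -/
def Veebar (F G : Polynomial ℝ) : Prop := Prec G (Polynomial.X * F)

/-- `F ∨ G` : `F ⋎ G` and no common zeros except possibly at the origin. -/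
def VeeS (F G : Polynomial ℝ) : Prop :=
  Veebar F G ∧ ∀ x : ℝ, x ≠ 0 → ¬ (F.eval x = 0 ∧ G.eval x = 0)

/-- `F ⊴ G` : `F ⋎ G` for polynomials with only nonpositive zeros. -/
def TriLE (F G : Polynomial ℝ) : Prop :=
  OnlyNonposRoots F ∧ OnlyNonposRoots G ∧ Veebar F G

/-- `F ◁ G` : `F ∨ G` for polynomials with only nonpositive zeros. -/
def TriLT (F G : Polynomial ℝ) : Prop :=
  OnlyNonposRoots F ∧ OnlyNonposRoots G ∧ VeeS F G

/-- `F` is extremal (in `𝓡̄_n(q)` or `𝓝̄_n(q)`): `F(z) = c · R_n(q; a z)` for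
nonzero reals `a`, `c`. -/
def Extremal (n : ℕ) (q : ℝ) (F : Polynomial ℝ) : Prop :=
  ∃ a c : ℝ, a ≠ 0 ∧ c ≠ 0 ∧
    F = Polynomial.C c * (Rpoly n q).comp (Polynomial.C a * Polynomial.X)

/-- The q-difference operator `Δ_{q,n}`. -/
def qDelta (q : ℝ) (n : ℕ) (F : Polynomial ℝ) : Polynomial ℝ :=
  if q = 1 then Polynomial.C ((n : ℝ)⁻¹) * Polynomial.derivative F
  else Polynomial.C (q ^ (n - 1) - q⁻¹)⁻¹ *
    (F - F.comp (Polynomial.C q⁻¹ * Polynomial.X)).divX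

/-- The operator `Δ*_{q,n}`. -/
def qDeltaStar (q : ℝ) (n : ℕ) (F : Polynomial ℝ) : Polynomial ℝ :=
  if q = 1 then F - Polynomial.C ((n : ℝ)⁻¹) * (Polynomial.X * Polynomial.derivative F)
  else Polynomial.C (q⁻¹ ^ n - 1)⁻¹ *
    (Polynomial.C (q⁻¹ ^ n) * F - F.comp (Polynomial.C q⁻¹ * Polynomial.X))

/-- The sequence `a_0, …, a_n` is strictly log-concave (`𝓛𝓒_n`):
`a_k² > a_{k-1} a_{k+1}` for every `k` for which there are `l ≤ k` and `m ≥ k`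
with `a_l ≠ 0 ≠ a_m` (with the convention `a_{-1} = 0`). -/
def LCcond (n : ℕ) (a : ℕ → ℝ) : Prop :=
  ∀ k ≤ n, (∃ l, l ≤ k ∧ a l ≠ 0) → (∃ m, k ≤ m ∧ m ≤ n ∧ a m ≠ 0) →
    (if k = 0 then (0 : ℝ) else a (k - 1)) * a (k + 1) < a k ^ 2

/-- `σ_n(ℝ)`: the zero polynomial together with the polynomials of degree `n` or
`n-1` with only real, simple zeros. -/
def sigmaR (n : ℕ) (P : Polynomial ℝ) : Prop :=
  P = 0 ∨ ((P.natDegree = n ∨ P.natDegree + 1 = n) ∧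
    P.roots.card = P.natDegree ∧ ∀ x ∈ P.roots, P.roots.count x = 1)

/-- `P` and `Q` have strictly interspersed zeros: `P'Q - PQ'` never vanishes. -/
def StrictInt (P Q : Polynomial ℝ) : Prop :=
  ∀ t : ℝ, (Polynomial.derivative P * Q - P * Polynomial.derivative Q).eval t ≠ 0

end

theorem Rpoly_succ (n : ℕ) (q : ℝ) :
    Rpoly (n + 1) q = Rpoly n q * (1 + C (q ^ n) * X) := by
  simp [Rpoly, Finset.prod_range_succ]

theorem Rpoly_succ_comp (n : ℕ) (q : ℝ) :
    Rpoly (n + 1) q = (Rpoly n q).comp (C q * X) * (1 + X) := by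
  simp only [Rpoly, Finset.prod_range_succ', Polynomial.prod_comp]
  congr 1
  · refine Finset.prod_congr rfl fun i _ => ?_
    simp only [add_comp, one_comp, mul_comp, C_comp, X_comp, pow_succ, C_mul]
    ring
  · simp

theorem qBinom_zero_right (n : ℕ) (q : ℝ) : qBinom n 0 q = 1 := by
  induction n with
  | zero => simp [qBinom, Rpoly]
  | succ n ih => simpa [qBinom, Rpoly_succ, mul_add, ← mul_assoc] using ih

theorem qBinom_succ_succ (n k : ℕ) (q : ℝ) :
    qBinom (n + 1) (k + 1) q = qBinom n (k + 1) q + q ^ n * qBinom n k q := by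
  simp only [qBinom, Rpoly_succ, mul_add, mul_one, coeff_add, ← mul_assoc, coeff_mul_X,
    coeff_mul_C]
  ring

theorem qBinom_succ_succ' (n k : ℕ) (q : ℝ) :
    qBinom (n + 1) (k + 1) q = q ^ (k + 1) * qBinom n (k + 1) q + q ^ k * qBinom n k q := by
  simp only [qBinom, Rpoly_succ_comp, mul_add, mul_one, coeff_add, coeff_mul_X,
    comp_C_mul_X_coeff]
  ring

theorem qBinom_eq_zero {n k : ℕ} (q : ℝ) (h : n < k) : qBinom n k q = 0 := by
  induction n generalizing k with
  | zero =>
    rw [qBinom, Rpoly, Finset.range_zero, Finset.prod_empty, coeff_one, if_neg (by omega)]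
  | succ n ih =>
    obtain ⟨k, rfl⟩ : ∃ j, k = j + 1 := ⟨k - 1, by omega⟩
    rw [qBinom_succ_succ, ih (by omega), ih (by omega)]
    simp

theorem qBinom_nonneg {q : ℝ} (hq : 0 < q) (n k : ℕ) : 0 ≤ qBinom n k q := by
  induction n generalizing k with
  | zero =>
    rcases Nat.eq_zero_or_pos k with rfl | hk
    · simp [qBinom_zero_right]
    · rw [qBinom_eq_zero q hk]
  | succ n ih =>
    cases k with
    | zero => simp [qBinom_zero_right]
    | succ k =>
      rw [qBinom_succ_succ]
      have := ih k
      have := ih (k + 1)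
      positivity

theorem qBinom_pos {q : ℝ} (hq : 0 < q) {n k : ℕ} (h : k ≤ n) : 0 < qBinom n k q := by
  induction n generalizing k with
  | zero =>
    obtain rfl : k = 0 := by omega
    simp [qBinom_zero_right]
  | succ n ih =>
    cases k with
    | zero => simp [qBinom_zero_right]
    | succ k =>
      rw [qBinom_succ_succ]
      have := ih (k := k) (by omega)
      have := qBinom_nonneg hq n (k + 1)
      positivity

theorem one_sub_pow_mul_qBinom {q : ℝ} (n k : ℕ) (hk : k ≤ n + 1) :
    (1 - q ^ (n + 1 - k)) * qBinom (n + 1) k q = (1 - q ^ (n + 1)) * qBinom n k q := by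
  cases k with
  | zero => simp [qBinom_zero_right]
  | succ k =>
    have h1 := qBinom_succ_succ n k q
    have h2 := qBinom_succ_succ' n k q
    obtain ⟨m, rfl⟩ : ∃ m, n = k + m := ⟨n - k, by omega⟩
    have e : k + m + 1 - (k + 1) = m := by omega
    rw [e, sub_mul, one_mul]
    nth_rewrite 1 [h1]
    rw [h2]
    ring

theorem qHadamard_coeff (n : ℕ) (q : ℝ) (F G : ℝ[X]) (k : ℕ) :
    (qHadamard n q F G).coeff k = F.coeff k * G.coeff k / qBinom n k q := by
  simp only [qHadamard, finsetSum_coeff, coeff_C_mul_X_pow]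
  rw [Finset.sum_ite_eq]
  split_ifs with h
  · rfl
  · rw [qBinom_eq_zero q (by simpa using h), div_zero]

theorem qHadamard_comm (n : ℕ) (q : ℝ) (F G : ℝ[X]) :
    qHadamard n q F G = qHadamard n q G F := by
  ext k
  simp only [qHadamard_coeff, mul_comm]

theorem qHadamard_add (n : ℕ) (q : ℝ) (F G H : ℝ[X]) :
    qHadamard n q F (G + H) = qHadamard n q F G + qHadamard n q F H := by
  ext k
  simp only [qHadamard_coeff, coeff_add]
  ring

theorem qHadamard_C_mul (n : ℕ) (q a : ℝ) (F G : ℝ[X]) :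
    qHadamard n q F (C a * G) = C a * qHadamard n q F G := by
  ext k
  simp only [qHadamard_coeff, coeff_C_mul]
  ring

/-- The Hadamard product with a fixed polynomial as a linear map. -/
noncomputable def qHadamardMap (n : ℕ) (q : ℝ) (F : ℝ[X]) : ℝ[X] →ₗ[ℝ] ℝ[X] where
  toFun := qHadamard n q F
  map_add' := qHadamard_add n q F
  map_smul' a G := by simp only [smul_eq_C_mul, qHadamard_C_mul, RingHom.id_apply]

theorem qHadamard_sum {ι : Type*} (n : ℕ) (q : ℝ) (F : ℝ[X]) (s : Finset ι) (G : ι → ℝ[X]) :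
    qHadamard n q F (∑ i ∈ s, G i) = ∑ i ∈ s, qHadamard n q F (G i) :=
  map_sum (qHadamardMap n q F) G s

theorem natDegree_qHadamard_le (n : ℕ) (q : ℝ) (F G : ℝ[X]) :
    (qHadamard n q F G).natDegree ≤ n := by
  rw [natDegree_le_iff_coeff_eq_zero]
  intro k hk
  rw [qHadamard_coeff, qBinom_eq_zero q hk, div_zero]

theorem qHadamard_comp (n : ℕ) (q a : ℝ) (F G : ℝ[X]) :
    qHadamard n q F (G.comp (C a * X)) = (qHadamard n q F G).comp (C a * X) := by
  ext k
  simp only [qHadamard_coeff, comp_C_mul_X_coeff]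
  ring

/-- The polynomial with coefficients `F_k C_k^n(q) / C_k^{n+1}(q)`. -/
noncomputable def lowerPart (n : ℕ) (q : ℝ) (F : ℝ[X]) : ℝ[X] := qHadamard (n + 1) q F (Rpoly n q)

/-- The polynomial with coefficients `F_{k+1} C_k^n(q) / C_{k+1}^{n+1}(q)`. -/
noncomputable def upperPart (n : ℕ) (q : ℝ) (F : ℝ[X]) : ℝ[X] :=
  (qHadamard (n + 1) q F (X * Rpoly n q)).divX

theorem lowerPart_coeff (n : ℕ) (q : ℝ) (F : ℝ[X]) (k : ℕ) :
    (lowerPart n q F).coeff k = F.coeff k * qBinom n k q / qBinom (n + 1) k q := by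
  rw [lowerPart, qHadamard_coeff]
  rfl

theorem upperPart_coeff (n : ℕ) (q : ℝ) (F : ℝ[X]) (k : ℕ) :
    (upperPart n q F).coeff k = F.coeff (k + 1) * qBinom n k q / qBinom (n + 1) (k + 1) q := by
  rw [upperPart, coeff_divX, qHadamard_coeff, coeff_X_mul]
  simp only [qBinom]

theorem qHadamard_succ_eq_lowerPart {n : ℕ} {q : ℝ} (hq : 0 < q) (F K : ℝ[X])
    (hK : K.natDegree ≤ n) :
    qHadamard (n + 1) q F K = qHadamard n q (lowerPart n q F) K := by
  ext k
  rw [qHadamard_coeff, qHadamard_coeff, lowerPart_coeff]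
  rcases le_or_gt k n with h | h
  · have := (qBinom_pos hq h).ne'
    field_simp
  · rw [coeff_eq_zero_of_natDegree_lt (hK.trans_lt h)]
    simp

theorem qHadamard_succ_X_mul {n : ℕ} {q : ℝ} (hq : 0 < q) (F K : ℝ[X])
    (hK : K.natDegree ≤ n) :
    qHadamard (n + 1) q F (X * K) = X * qHadamard n q (upperPart n q F) K := by
  ext k
  cases k with
  | zero => simp [qHadamard_coeff]
  | succ k =>
    rw [coeff_X_mul, qHadamard_coeff, qHadamard_coeff, upperPart_coeff, coeff_X_mul]
    rcases le_or_gt k n with h | h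
    · have := (qBinom_pos hq h).ne'
      field_simp
    · rw [coeff_eq_zero_of_natDegree_lt (hK.trans_lt h)]
      simp

theorem lowerPart_add_upperPart {n : ℕ} {q : ℝ} (hq : 0 < q) {F : ℝ[X]}
    (hF : F.natDegree ≤ n + 1) :
    F = lowerPart n q F + C (q ^ n) * (X * upperPart n q F) := by
  ext k
  rw [coeff_add, coeff_C_mul, lowerPart_coeff]
  cases k with
  | zero => simp [qBinom_zero_right]
  | succ k =>
    rw [coeff_X_mul, upperPart_coeff]
    rcases le_or_gt (k + 1) (n + 1) with h | h
    · have := (qBinom_pos hq h).ne'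
      field_simp
      rw [qBinom_succ_succ]
    · rw [coeff_eq_zero_of_natDegree_lt (hF.trans_lt h)]
      simp

theorem lowerPart_eq_sub {n : ℕ} {q : ℝ} (hq : 0 < q) {F : ℝ[X]} (hF : F.natDegree ≤ n + 1) :
    C (1 - q ^ (n + 1)) * lowerPart n q F = F - C (q ^ (n + 1)) * F.comp (C q⁻¹ * X) := by
  ext k
  rw [coeff_sub, coeff_C_mul, coeff_C_mul, lowerPart_coeff, comp_C_mul_X_coeff]
  rcases le_or_gt k (n + 1) with h | h
  · have h1 := (qBinom_pos hq h).ne'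
    have h2 := one_sub_pow_mul_qBinom (q := q) n k h
    have h3 : q ^ (n + 1) * q⁻¹ ^ k = q ^ (n + 1 - k) := by
      rw [pow_sub₀ _ hq.ne' h, inv_pow]
    calc _ = F.coeff k * ((1 - q ^ (n + 1)) * qBinom n k q) / qBinom (n + 1) k q := by ring
      _ = F.coeff k * (1 - q ^ (n + 1 - k)) := by rw [← h2]; field_simp
      _ = _ := by rw [← h3]; ring
  · rw [coeff_eq_zero_of_natDegree_lt (hF.trans_lt h)]
    simp

/-- `Im (P / S) ≤ 0` on the upper half plane, cleared of denominators. -/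
def LowerIm (S P : ℝ[X]) : Prop :=
  ∀ z : ℂ, 0 < z.im → (aeval z P * (starRingEnd ℂ) (aeval z S)).im ≤ 0

/-- `Im (Q / P) ≤ 0 ≤ Im (z Q / P)` on the upper half plane, cleared of denominators. -/
def Stieltjes (P Q : ℝ[X]) : Prop :=
  LowerIm P Q ∧ ∀ z : ℂ, 0 < z.im → 0 ≤ (z * aeval z Q * (starRingEnd ℂ) (aeval z P)).im

theorem LowerIm.self (S : ℝ[X]) : LowerIm S S := by
  intro z _
  rw [Complex.mul_conj]
  simp

theorem LowerIm.add {S P Q : ℝ[X]} (h1 : LowerIm S P) (h2 : LowerIm S Q) :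
    LowerIm S (P + Q) := by
  intro z hz
  have := h1 z hz
  have := h2 z hz
  rw [map_add, add_mul, Complex.add_im]
  linarith

theorem LowerIm.C_mul {S P : ℝ[X]} {c : ℝ} (hc : 0 ≤ c) (h : LowerIm S P) :
    LowerIm S (C c * P) := by
  intro z hz
  have := h z hz
  rw [map_mul, aeval_C, Complex.coe_algebraMap, mul_assoc, Complex.im_ofReal_mul]
  nlinarith

theorem Stieltjes.self (S : ℝ[X]) : Stieltjes S S := by
  refine ⟨LowerIm.self S, fun z hz => ?_⟩
  rw [mul_assoc, Complex.mul_conj, Complex.im_mul_ofReal]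
  have := Complex.normSq_nonneg (aeval z S)
  positivity

theorem Stieltjes.add {S P Q : ℝ[X]} (h1 : Stieltjes S P) (h2 : Stieltjes S Q) :
    Stieltjes S (P + Q) := by
  refine ⟨h1.1.add h2.1, fun z hz => ?_⟩
  have := h1.2 z hz
  have := h2.2 z hz
  rw [map_add, mul_add, add_mul, Complex.add_im]
  linarith

theorem Stieltjes.C_mul {S P : ℝ[X]} {c : ℝ} (hc : 0 ≤ c) (h : Stieltjes S P) :
    Stieltjes S (C c * P) := by
  refine ⟨h.1.C_mul hc, fun z hz => ?_⟩
  have := h.2 z hz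
  have e : z * aeval z (C c * P) * (starRingEnd ℂ) (aeval z S)
      = c * (z * aeval z P * (starRingEnd ℂ) (aeval z S)) := by
    rw [map_mul, aeval_C, Complex.coe_algebraMap]
    ring
  rw [e, Complex.im_ofReal_mul]
  positivity

theorem LowerIm.zero (S : ℝ[X]) : LowerIm S 0 := by
  intro z _
  simp

theorem LowerIm.sum {ι : Type*} {S : ℝ[X]} {s : Finset ι} {P : ι → ℝ[X]}
    (h : ∀ i ∈ s, LowerIm S (P i)) : LowerIm S (∑ i ∈ s, P i) :=
  Finset.sum_induction _ (LowerIm S) (fun _ _ => LowerIm.add) (LowerIm.zero S) h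

theorem Stieltjes.zero (S : ℝ[X]) : Stieltjes S 0 := by
  refine ⟨LowerIm.zero S, fun z _ => ?_⟩
  simp

theorem Stieltjes.sum {ι : Type*} {S : ℝ[X]} {s : Finset ι} {P : ι → ℝ[X]}
    (h : ∀ i ∈ s, Stieltjes S (P i)) : Stieltjes S (∑ i ∈ s, P i) :=
  Finset.sum_induction _ (Stieltjes S) (fun _ _ => Stieltjes.add) (Stieltjes.zero S) h

theorem Stieltjes.X_mul_add {P Q : ℝ[X]} {a : ℝ} (ha : 0 ≤ a) (h : Stieltjes P Q) :
    Stieltjes (X * Q + C a * P) P := by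
  refine ⟨fun z hz => ?_, fun z hz => ?_⟩
  · have := h.2 z hz
    have h0 := Complex.mul_conj (aeval z P)
    have e : aeval z P * (starRingEnd ℂ) (aeval z (X * Q + C a * P))
        = (starRingEnd ℂ) (z * aeval z Q * (starRingEnd ℂ) (aeval z P))
          + (a * Complex.normSq (aeval z P) : ℝ) := by
      push_cast
      rw [← h0]
      simp only [map_add, map_mul, aeval_X, aeval_C, Complex.coe_algebraMap,
        Complex.conj_ofReal, Complex.conj_conj]
      ring
    rw [e, Complex.add_im, Complex.conj_im, Complex.ofReal_im]
    linarith
  · have := h.1 z hz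
    have h0 := Complex.mul_conj (aeval z P)
    have h1 := Complex.mul_conj z
    have e : z * aeval z P * (starRingEnd ℂ) (aeval z (X * Q + C a * P))
        = (Complex.normSq z : ℝ) * (starRingEnd ℂ) (aeval z Q * (starRingEnd ℂ) (aeval z P))
          + z * (a * Complex.normSq (aeval z P) : ℝ) := by
      push_cast
      rw [← h0, ← h1]
      simp only [map_add, map_mul, aeval_X, aeval_C, Complex.coe_algebraMap,
        Complex.conj_ofReal, Complex.conj_conj]
      ring
    rw [e, Complex.add_im, Complex.im_ofReal_mul, Complex.im_mul_ofReal, Complex.conj_im]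
    have := Complex.normSq_nonneg (aeval z P)
    have := Complex.normSq_nonneg z
    have : 0 ≤ Complex.normSq z * -(aeval z Q * (starRingEnd ℂ) (aeval z P)).im :=
      mul_nonneg ‹_› (by linarith)
    positivity

theorem LowerIm.X_add_C_mul (K : ℝ[X]) (a : ℝ) : LowerIm ((X + C a) * K) K := by
  intro z hz
  have h0 := Complex.mul_conj (aeval z K)
  have e : aeval z K * (starRingEnd ℂ) (aeval z ((X + C a) * K))
      = (starRingEnd ℂ) (z + a) * (Complex.normSq (aeval z K) : ℝ) := by
    rw [← h0]
    simp only [map_add, map_mul, aeval_X, aeval_C, Complex.coe_algebraMap, Complex.conj_ofReal]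
    ring
  rw [e, Complex.im_mul_ofReal, Complex.conj_im]
  have := Complex.normSq_nonneg (aeval z K)
  have : (z + a).im = z.im := by simp
  rw [this]
  nlinarith

theorem Stieltjes.X_mul_add_ne_zero {P Q : ℝ[X]} {a : ℝ} (ha : 0 < a) (h : Stieltjes P Q)
    {z : ℂ} (hz : 0 < z.im) (hP : aeval z P ≠ 0) : aeval z (X * Q + C a * P) ≠ 0 := by
  intro h0
  have h1 := h.1 z hz
  simp only [map_add, map_mul, aeval_X, aeval_C, Complex.coe_algebraMap] at h0
  have hN : 0 < Complex.normSq (aeval z P) := Complex.normSq_pos.2 hP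
  have hz2 : 0 < Complex.normSq z := Complex.normSq_pos.2 (by rintro rfl; simp at hz)
  have e : (Complex.normSq z : ℂ) * (aeval z Q * (starRingEnd ℂ) (aeval z P))
      = -(starRingEnd ℂ) z * (a * Complex.normSq (aeval z P) : ℝ) := by
    push_cast
    rw [← Complex.mul_conj, ← Complex.mul_conj]
    linear_combination (starRingEnd ℂ) z * (starRingEnd ℂ) (aeval z P) * h0
  have e2 := congrArg Complex.im e
  rw [Complex.im_ofReal_mul, Complex.im_mul_ofReal, Complex.neg_im, Complex.conj_im] at e2
  have : 0 < - -z.im * (a * Complex.normSq (aeval z P)) := by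
    rw [neg_neg]
    positivity
  nlinarith

theorem LowerIm.deriv_mul_nonneg_or {S P : ℝ[X]} (hS : S ≠ 0) (h : LowerIm S P) {y : ℝ}
    (hy : S.eval y = 0) :
    (derivative S).eval y ≠ 0 ∧ 0 ≤ (derivative S).eval y * P.eval y ∨ P.eval y = 0 := by
  obtain ⟨S1, hS1, hnd⟩ := exists_eq_pow_rootMultiplicity_mul_and_not_dvd S hS y
  have hm : 0 < S.rootMultiplicity y := (rootMultiplicity_pos hS).2 hy
  set m := S.rootMultiplicity y
  have hS1y : S1.eval y ≠ 0 := fun h0 => hnd (dvd_iff_isRoot.2 h0)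
  have key : ∀ w : ℂ, 0 < w.im → 0 ≤ P.eval y * S1.eval y * (w ^ m).im := by
    intro w hw
    have hlim : Tendsto (fun ε : ℝ => (aeval ((y : ℂ) + ε * w) P *
        (starRingEnd ℂ) (w ^ m * aeval ((y : ℂ) + ε * w) S1)).im) (nhdsWithin 0 (Set.Ioi 0))
        (nhds (aeval ((y : ℂ) + (0 : ℝ) * w) P *
          (starRingEnd ℂ) (w ^ m * aeval ((y : ℂ) + (0 : ℝ) * w) S1)).im) := by
      refine (Continuous.tendsto ?_ (0 : ℝ)).mono_left nhdsWithin_le_nhds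
      have hP : Continuous fun z : ℂ => aeval z P := P.continuous_aeval
      have hS : Continuous fun z : ℂ => aeval z S1 := S1.continuous_aeval
      have hl : Continuous fun ε : ℝ => (y : ℂ) + ε * w := by fun_prop
      exact Complex.continuous_im.comp ((hP.comp hl).mul
        (Complex.continuous_conj.comp (continuous_const.mul (hS.comp hl))))
    have hle := le_of_tendsto hlim (b := 0) (by
      filter_upwards [self_mem_nhdsWithin] with ε hε
      have hε : 0 < ε := hε
      have h1 := h ((y : ℂ) + ε * w) (by simp; positivity)
      have e : aeval ((y : ℂ) + ε * w) P * (starRingEnd ℂ) (aeval ((y : ℂ) + ε * w) S)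
          = (ε ^ m : ℝ) * (aeval ((y : ℂ) + ε * w) P *
            (starRingEnd ℂ) (w ^ m * aeval ((y : ℂ) + ε * w) S1)) := by
        rw [hS1]
        simp only [map_mul, map_pow, map_sub, aeval_X, aeval_C, Complex.coe_algebraMap,
          map_add, Complex.conj_ofReal]
        push_cast
        ring
      rw [e, Complex.im_ofReal_mul] at h1
      exact nonpos_of_mul_nonpos_right h1 (by positivity))
    have ey : ∀ R : ℝ[X], aeval ((y : ℂ) + (0 : ℝ) * w) R = ((R.eval y : ℝ) : ℂ) := by
      intro R
      rw [Complex.ofReal_zero, zero_mul, add_zero]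
      exact aeval_algebraMap_apply_eq_algebraMap_eval y R
    rw [ey, ey, map_mul, Complex.conj_ofReal, mul_comm ((starRingEnd ℂ) (w ^ m)), ← mul_assoc,
      ← Complex.ofReal_mul, Complex.im_ofReal_mul, Complex.conj_im] at hle
    linarith
  rcases Nat.lt_or_ge 1 m with h2 | h2
  · right
    have hπ := Real.pi_pos
    have hm2 : (2 : ℝ) ≤ m := by exact_mod_cast h2
    have k1 := key (Complex.exp ((Real.pi / (2 * m) : ℝ) * Complex.I)) (by
      rw [Complex.exp_ofReal_mul_I_im]
      refine Real.sin_pos_of_pos_of_lt_pi (by positivity) ?_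
      rw [div_lt_iff₀ (by positivity)]
      nlinarith)
    have k3 := key (Complex.exp ((3 * Real.pi / (2 * m) : ℝ) * Complex.I)) (by
      rw [Complex.exp_ofReal_mul_I_im]
      refine Real.sin_pos_of_pos_of_lt_pi (by positivity) ?_
      rw [div_lt_iff₀ (by positivity)]
      nlinarith)
    have hm0 : (m : ℝ) ≠ 0 := by positivity
    have e1 : (m : ℂ) * ((Real.pi / (2 * m) : ℝ) * Complex.I) = (Real.pi / 2 : ℝ) * Complex.I := by
      rw [← mul_assoc, ← Complex.ofReal_natCast, ← Complex.ofReal_mul]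
      congr 2
      field_simp
    have e3 : (m : ℂ) * ((3 * Real.pi / (2 * m) : ℝ) * Complex.I)
        = (Real.pi / 2 + Real.pi : ℝ) * Complex.I := by
      rw [← mul_assoc, ← Complex.ofReal_natCast, ← Complex.ofReal_mul]
      congr 2
      field_simp
      ring
    rw [← Complex.exp_nat_mul, e1, Complex.exp_ofReal_mul_I_im, Real.sin_pi_div_two] at k1
    rw [← Complex.exp_nat_mul, e3, Complex.exp_ofReal_mul_I_im, Real.sin_add_pi,
      Real.sin_pi_div_two] at k3
    have : P.eval y * S1.eval y = 0 := by linarith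
    exact (mul_eq_zero.1 this).resolve_right hS1y
  · left
    have hm1 : m = 1 := by omega
    have hd : (derivative S).eval y = S1.eval y := by
      rw [hS1, hm1]
      simp
    have k := key Complex.I (by simp)
    rw [hm1, pow_one, Complex.I_im] at k
    rw [hd]
    exact ⟨hS1y, by linarith⟩

/-- The monic polynomial with simple zeros at the negatives of the elements of `s`. -/
noncomputable def rootProd (s : Finset ℝ) : ℝ[X] := ∏ x ∈ s, (X + C x)

theorem rootProd_monic (s : Finset ℝ) : (rootProd s).Monic :=
  monic_prod_of_monic _ _ fun x _ => monic_X_add_C x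

theorem natDegree_rootProd (s : Finset ℝ) : (rootProd s).natDegree = s.card := by
  rw [rootProd, natDegree_prod_of_monic _ _ fun x _ => monic_X_add_C x]
  simp

theorem X_add_C_mul_rootProd_erase {s : Finset ℝ} {x : ℝ} (hx : x ∈ s) :
    (X + C x) * rootProd (s.erase x) = rootProd s :=
  Finset.mul_prod_erase s (fun y => X + C y) hx

theorem eval_rootProd (s : Finset ℝ) (y : ℝ) : (rootProd s).eval y = ∏ x ∈ s, (y + x) := by
  simp [rootProd, eval_prod]

theorem eval_neg_rootProd_eq_zero {s : Finset ℝ} {x : ℝ} (hx : x ∈ s) :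
    (rootProd s).eval (-x) = 0 := by
  rw [eval_rootProd]
  exact Finset.prod_eq_zero hx (by ring)

theorem coeff_rootProd_pos {s : Finset ℝ} (hs : ∀ x ∈ s, 0 < x) {k : ℕ} (hk : k ≤ s.card) :
    0 < (rootProd s).coeff k := by
  induction s using Finset.induction_on generalizing k with
  | empty =>
    obtain rfl : k = 0 := by simpa using hk
    simp [rootProd]
  | insert a s ha ih =>
    have hpos : 0 < a := hs a (Finset.mem_insert_self a s)
    have ih' : ∀ {k : ℕ}, k ≤ s.card → 0 < (rootProd s).coeff k :=
      ih fun x hx => hs x (Finset.mem_insert_of_mem hx)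
    have e : rootProd (insert a s) = X * rootProd s + C a * rootProd s := by
      rw [rootProd, Finset.prod_insert ha, add_mul, ← rootProd]
    rw [Finset.card_insert_of_notMem ha] at hk
    rw [e, coeff_add, coeff_C_mul]
    cases k with
    | zero =>
      rw [coeff_X_mul_zero, zero_add]
      exact mul_pos hpos (ih' (Nat.zero_le _))
    | succ k =>
      rw [coeff_X_mul]
      have h1 := ih' (k := k) (by omega)
      rcases Nat.lt_or_ge s.card (k + 1) with h | h
      · rw [coeff_eq_zero_of_natDegree_lt ((natDegree_rootProd s).trans_lt h)]
        simpa using h1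
      · have h2 := ih' h
        positivity

theorem eq_partialFraction (s : Finset ℝ) (H : ℝ[X]) (hH : H.natDegree ≤ s.card) :
    H = C (H.coeff s.card) * rootProd s +
      ∑ x ∈ s, C (H.eval (-x) / ∏ y ∈ s.erase x, (y - x)) * rootProd (s.erase x) := by
  refine eq_of_degree_sub_lt_of_eval_index_eq s (v := fun x => -x) neg_injective.injOn ?_ ?_
  · rw [degree_lt_iff_coeff_zero]
    intro m hm
    rw [coeff_sub, coeff_add, coeff_C_mul, finsetSum_coeff, Finset.sum_eq_zero, add_zero]
    · rcases hm.eq_or_lt with rfl | h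
      · have := (rootProd_monic s).coeff_natDegree
        rw [natDegree_rootProd] at this
        rw [this]
        ring
      · rw [coeff_eq_zero_of_natDegree_lt (hH.trans_lt h),
          coeff_eq_zero_of_natDegree_lt ((natDegree_rootProd s).trans_lt h)]
        ring
    · intro x hx
      have : (s.erase x).card < m := (Finset.card_erase_lt_of_mem hx).trans_le hm
      rw [coeff_C_mul, coeff_eq_zero_of_natDegree_lt ((natDegree_rootProd _).trans_lt this),
        mul_zero]
  · intro x hx
    rw [eval_add, eval_mul, eval_neg_rootProd_eq_zero hx, mul_zero, zero_add, eval_finsetSum,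
      Finset.sum_eq_single_of_mem x hx]
    · rw [eval_mul, eval_C, eval_rootProd]
      simp only [neg_add_eq_sub]
      rw [div_mul_cancel₀]
      refine Finset.prod_ne_zero_iff.2 fun y hy => sub_ne_zero.2 (Finset.ne_of_mem_erase hy)
    · intro y _ hyx
      rw [eval_mul, eval_neg_rootProd_eq_zero (Finset.mem_erase.2 ⟨hyx.symm, hx⟩), mul_zero]

/-- The elements of `s` are positive and strictly logarithmically `q`-separated. -/
def StrictSep (q : ℝ) (s : Finset ℝ) : Prop :=
  (∀ x ∈ s, 0 < x) ∧ ∀ x ∈ s, ∀ y ∈ s, x < y → x < q * y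

theorem StrictSep.mono {q : ℝ} {s t : Finset ℝ} (h : StrictSep q s) (hts : t ⊆ s) :
    StrictSep q t :=
  ⟨fun x hx => h.1 x (hts hx), fun x hx y hy => h.2 x (hts hx) y (hts hy)⟩

theorem exists_root_of_eval_mul_neg {f : ℝ → ℝ} (hf : Continuous f) {u v : ℝ} (huv : u ≤ v)
    (h : f u * f v < 0) : ∃ c, u < c ∧ c < v ∧ f c = 0 := by
  rcases mul_neg_iff.1 h with ⟨h1, h2⟩ | ⟨h1, h2⟩
  · obtain ⟨c, hc, h0⟩ := intermediate_value_Ioo' huv hf.continuousOn ⟨h2, h1⟩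
    exact ⟨c, hc.1, hc.2, h0⟩
  · obtain ⟨c, hc, h0⟩ := intermediate_value_Ioo huv hf.continuousOn ⟨h1, h2⟩
    exact ⟨c, hc.1, hc.2, h0⟩

theorem exists_lowerPart_eq {n : ℕ} {q : ℝ} (hq0 : 0 < q) (hq1 : q < 1) {s : Finset ℝ}
    (hs : StrictSep q s) (hcard : s.card = n + 1) :
    ∃ (b : Finset ℝ) (a : ℝ), b.card = n ∧ StrictSep q b ∧ 0 < a ∧
      lowerPart n q (rootProd s) = C a * rootProd b ∧
      ∀ x ∈ b, 0 ≤ (upperPart n q (rootProd s)).eval (-x) / ∏ y ∈ b.erase x, (y - x) := by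
  set F := rootProd s with hF
  have hdeg : F.natDegree ≤ n + 1 := (natDegree_rootProd s).trans_le hcard.le
  set t := s.orderEmbOfFin hcard with ht
  have htmem : ∀ i, t i ∈ s := fun i => s.orderEmbOfFin_mem hcard i
  have htpos : ∀ i, 0 < t i := fun i => hs.1 _ (htmem i)
  have htsep : ∀ i j, i < j → t i < q * t j := fun i j hij =>
    hs.2 _ (htmem i) _ (htmem j) (t.lt_iff_lt.2 hij)
  have hFt : ∀ y, F.eval y = ∏ i, (y + t i) := by
    intro y
    rw [hF, eval_rootProd, ← Finset.image_orderEmbOfFin_univ s hcard,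
      Finset.prod_image t.injective.injOn]
  have hq1' : 0 < 1 - q ^ (n + 1) := sub_pos.2 (pow_lt_one₀ hq0.le hq1 (by omega))
  have hA : ∀ x, (1 - q ^ (n + 1)) * (lowerPart n q F).eval (-x) =
      F.eval (-x) - q ^ (n + 1) * F.eval (-(x / q)) := by
    intro x
    have := congrArg (eval (-x)) (lowerPart_eq_sub hq0 hdeg)
    simp only [eval_mul, eval_C, eval_sub, eval_comp, eval_X] at this
    rw [this, mul_neg, inv_mul_eq_div]
  have hex : ∀ i : Fin n, ∃ c, t i.castSucc < c ∧ c < q * t i.succ ∧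
      (lowerPart n q F).eval (-c) = 0 := by
    intro i
    have hlt : t i.castSucc < q * t i.succ := htsep _ _ i.castSucc_lt_succ
    refine exists_root_of_eval_mul_neg
      ((lowerPart n q F).continuous.comp continuous_neg) hlt.le ?_
    have e1 : F.eval (-t i.castSucc) = 0 := eval_neg_rootProd_eq_zero (htmem _)
    have e2 : F.eval (-(q * t i.succ / q)) = 0 := by
      rw [mul_div_cancel_left₀ _ hq0.ne']
      exact eval_neg_rootProd_eq_zero (htmem _)
    have h1 := hA (t i.castSucc)
    have h2 := hA (q * t i.succ)
    rw [e1] at h1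
    rw [e2] at h2
    have hp : 0 < F.eval (-(t i.castSucc / q)) * F.eval (-(q * t i.succ)) := by
      rw [hFt, hFt, ← Finset.prod_mul_distrib]
      refine Finset.prod_pos fun k _ => ?_
      have hi0 := htpos i.castSucc
      have hi1 := htpos i.succ
      have hd : t i.castSucc < t i.castSucc / q := by
        rw [lt_div_iff₀ hq0]
        nlinarith
      have hd2 : t i.castSucc / q < t i.succ := by
        rw [div_lt_iff₀ hq0]
        linarith
      rcases le_or_gt k i.castSucc with hk | hk
      · have := t.monotone hk
        exact mul_pos_of_neg_of_neg (by linarith) (by linarith)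
      · have := t.monotone (Fin.castSucc_lt_iff_succ_le.1 hk)
        exact mul_pos (by linarith) (by nlinarith)
    have hqn : 0 < q ^ (n + 1) := by positivity
    have : (1 - q ^ (n + 1)) ^ 2 * ((lowerPart n q F).eval (-t i.castSucc) *
        (lowerPart n q F).eval (-(q * t i.succ))) < 0 := by
      calc _ = ((1 - q ^ (n + 1)) * (lowerPart n q F).eval (-t i.castSucc)) *
          ((1 - q ^ (n + 1)) * (lowerPart n q F).eval (-(q * t i.succ))) := by ring
        _ = - (q ^ (n + 1) * (F.eval (-(t i.castSucc / q)) * F.eval (-(q * t i.succ)))) := by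
          rw [h1, h2]; ring
        _ < 0 := by
          have := mul_pos hqn hp
          linarith
    exact neg_of_mul_neg_right this (by positivity)
  choose b hb1 hb2 hb3 using hex
  have hbpos : ∀ i, 0 < b i := fun i => (htpos _).trans (hb1 i)
  have hbsep : ∀ i j, i < j → b i < q * b j := by
    intro i j hij
    have h1 : t i.succ ≤ t j.castSucc := t.monotone (by
      rw [Fin.le_def]
      simpa using hij)
    have := hb1 j
    have := hb2 i
    nlinarith
  have hbmono : StrictMono b := by
    intro i j hij
    have := hbsep i j hij
    have := hbpos j
    nlinarith
  have hbcard : (Finset.univ.image b).card = n := by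
    rw [Finset.card_image_of_injective _ hbmono.injective]
    simp
  have hAdeg : (lowerPart n q F).natDegree ≤ (Finset.univ.image b).card := by
    rw [hbcard, natDegree_le_iff_coeff_eq_zero]
    intro k hk
    rw [lowerPart_coeff, qBinom_eq_zero q hk]
    simp
  refine ⟨Finset.univ.image b, (lowerPart n q F).coeff n, hbcard, ⟨?_, ?_⟩, ?_, ?_, ?_⟩
  · simpa using hbpos
  · intro x hx y hy hxy
    obtain ⟨i, -, rfl⟩ := Finset.mem_image.1 hx
    obtain ⟨j, -, rfl⟩ := Finset.mem_image.1 hy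
    exact hbsep i j (hbmono.lt_iff_lt.1 hxy)
  · rw [lowerPart_coeff]
    have h1 := coeff_rootProd_pos hs.1 (k := n) (by omega)
    have h2 := qBinom_pos hq0 (le_refl n)
    have h3 := qBinom_pos hq0 (Nat.le_succ n)
    positivity
  · have := eq_partialFraction _ _ hAdeg
    rw [Finset.sum_eq_zero, add_zero, hbcard] at this
    · exact this
    · intro x hx
      obtain ⟨i, -, rfl⟩ := Finset.mem_image.1 hx
      rw [hb3]
      simp
  · intro x hx
    obtain ⟨i, -, rfl⟩ := Finset.mem_image.1 hx
    rw [← Finset.image_erase hbmono.injective, Finset.prod_image hbmono.injective.injOn]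
    set D := ∏ k ∈ Finset.univ.erase i, (b k - b i) with hD
    have h1 := congrArg (eval (-b i)) (lowerPart_add_upperPart hq0 hdeg)
    simp only [eval_add, eval_mul, eval_C, eval_X, hb3, zero_add] at h1
    have h2 : F.eval (-b i) * D ≤ 0 := by
      rw [hFt, Fin.prod_univ_castSucc, ← Finset.mul_prod_erase _ _ (Finset.mem_univ i)]
      have h3 : 0 ≤ (∏ k ∈ Finset.univ.erase i, (-b i + t k.castSucc)) * D := by
        rw [hD, ← Finset.prod_mul_distrib]
        refine Finset.prod_nonneg fun k hk => ?_
        rcases lt_or_gt_of_ne (Finset.ne_of_mem_erase hk) with h | h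
        · have := hbmono h
          have := hb1 k
          exact mul_nonneg_of_nonpos_of_nonpos (by linarith) (by linarith)
        · have h4 : t i.succ ≤ t k.castSucc := t.monotone (by
            rw [Fin.le_def]
            simpa using h)
          have := hb2 i
          have := hb1 k
          have := htpos i.succ
          exact mul_nonneg (by nlinarith) (by nlinarith)
      have h5 : -b i + t i.castSucc ≤ 0 := by linarith [hb1 i]
      have h6 : 0 ≤ -b i + t (Fin.last n) := by
        have := t.monotone (Fin.le_last i.succ)
        have := hb2 i
        have := htpos i.succ
        nlinarith
      calc _ = (-b i + t i.castSucc) * ((-b i + t (Fin.last n)) *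
          ((∏ k ∈ Finset.univ.erase i, (-b i + t k.castSucc)) * D)) := by ring
        _ ≤ 0 := mul_nonpos_of_nonpos_of_nonneg h5 (mul_nonneg h6 h3)
    rw [h1] at h2
    have h7 : 0 ≤ q ^ n * b i * ((upperPart n q F).eval (-b i) * D) := by linarith
    have h8 : 0 ≤ (upperPart n q F).eval (-b i) * D :=
      nonneg_of_mul_nonneg_right h7 (mul_pos (by positivity) (hbpos i))
    have : (upperPart n q F).eval (-b i) / D = (upperPart n q F).eval (-b i) * D / D ^ 2 := by
      rcases eq_or_ne D 0 with h | h
      · simp [h]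
      · field_simp
    rw [this]
    positivity

theorem Stieltjes.C_mul_left {S P : ℝ[X]} {c : ℝ} (hc : 0 ≤ c) (h : Stieltjes S P) :
    Stieltjes (C c * S) P := by
  have e : ∀ z w : ℂ, w * (starRingEnd ℂ) (aeval z (C c * S))
      = c * (w * (starRingEnd ℂ) (aeval z S)) := by
    intro z w
    rw [map_mul, aeval_C, Complex.coe_algebraMap, map_mul, Complex.conj_ofReal]
    ring
  refine ⟨fun z hz => ?_, fun z hz => ?_⟩
  · have := h.1 z hz
    rw [e, Complex.im_ofReal_mul]
    nlinarith
  · have := h.2 z hz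
    rw [e, Complex.im_ofReal_mul]
    positivity

theorem natDegree_upperPart_le (n : ℕ) (q : ℝ) (F : ℝ[X]) : (upperPart n q F).natDegree ≤ n := by
  rw [natDegree_le_iff_coeff_eq_zero]
  intro k hk
  rw [upperPart_coeff, qBinom_eq_zero q hk, mul_zero, zero_div]

theorem qHadamard_rootProd_stieltjes {q : ℝ} (hq0 : 0 < q) (hq1 : q < 1) (n : ℕ)
    {s t : Finset ℝ} (hs : StrictSep q s) (ht : StrictSep q t) (hsn : s.card = n)
    (htn : t.card = n) :
    (∀ z : ℂ, 0 < z.im → aeval z (qHadamard n q (rootProd s) (rootProd t)) ≠ 0) ∧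
      ∀ x ∈ t, Stieltjes (qHadamard n q (rootProd s) (rootProd t))
        (qHadamard n q (rootProd s) (rootProd (t.erase x))) := by
  induction n generalizing s t with
  | zero =>
    rw [Finset.card_eq_zero] at hsn htn
    subst hsn htn
    refine ⟨fun z _ => ?_, fun x hx => absurd hx (Finset.notMem_empty x)⟩
    simp [rootProd, qHadamard, qBinom, Rpoly]
  | succ n ih =>
    obtain ⟨b, a, hbn, hb, ha, hlow, hup⟩ := exists_lowerPart_eq hq0 hq1 hs hsn
    have interlace : ∀ x ∈ t, Stieltjes (qHadamard (n + 1) q (rootProd s) (rootProd t))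
        (qHadamard (n + 1) q (rootProd s) (rootProd (t.erase x))) ∧
        ∀ z : ℂ, 0 < z.im → aeval z (qHadamard (n + 1) q (rootProd s) (rootProd t)) ≠ 0 := by
      intro x hx
      have hcard : (t.erase x).card = n := by rw [Finset.card_erase_of_mem hx, htn]; rfl
      have hKdeg : (rootProd (t.erase x)).natDegree ≤ n := by rw [natDegree_rootProd, hcard]
      obtain ⟨hne, hst⟩ := ih (ht.mono (t.erase_subset x)) hb hcard hbn
      set K := rootProd (t.erase x) with hK
      set T := qHadamard n q K (rootProd b) with hT
      have hQ : Stieltjes T (qHadamard n q (upperPart n q (rootProd s)) K) := by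
        rw [qHadamard_comm, eq_partialFraction b (upperPart n q (rootProd s))
          (by rw [hbn]; exact natDegree_upperPart_le _ _ _), qHadamard_add, qHadamard_C_mul,
          qHadamard_sum]
        refine ((Stieltjes.self T).C_mul ?_).add (Stieltjes.sum fun y hy => ?_)
        · rw [hbn, upperPart_coeff]
          exact div_nonneg (mul_nonneg (coeff_rootProd_pos hs.1 (by omega)).le
            (qBinom_nonneg hq0 _ _)) (qBinom_nonneg hq0 _ _)
        · rw [qHadamard_C_mul]
          exact (hst y hy).C_mul (hup y hy)
      have hP : qHadamard (n + 1) q (rootProd s) K = C a * T := by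
        rw [qHadamard_succ_eq_lowerPart hq0 _ _ hKdeg, hlow, qHadamard_comm, qHadamard_C_mul]
      have hS : qHadamard (n + 1) q (rootProd s) (rootProd t)
          = X * qHadamard n q (upperPart n q (rootProd s)) K + C x * (C a * T) := by
        rw [← X_add_C_mul_rootProd_erase hx, add_mul, qHadamard_add, qHadamard_C_mul, hP,
          qHadamard_succ_X_mul hq0 _ _ hKdeg]
      have hx0 := ht.1 x hx
      have hQ' := hQ.C_mul_left ha.le
      rw [hS, hP]
      refine ⟨hQ'.X_mul_add hx0.le, fun z hz => hQ'.X_mul_add_ne_zero hx0 hz ?_⟩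
      rw [map_mul, aeval_C]
      exact mul_ne_zero (by simpa using ha.ne') (hne z hz)
    obtain ⟨x, hx⟩ : t.Nonempty := Finset.card_pos.1 (by omega)
    exact ⟨(interlace x hx).2, fun y hy => (interlace y hy).1⟩

theorem card_roots_eq_of_aeval_ne_zero {P : ℝ[X]} (hP : P ≠ 0)
    (h : ∀ z : ℂ, 0 < z.im → aeval z P ≠ 0) : P.roots.card = P.natDegree := by
  rw [← splits_iff_card_roots]
  refine Splits.of_splits_map (algebraMap ℝ ℂ) (IsAlgClosed.splits _) fun a ha => ?_
  have h0 : aeval a P = 0 := by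
    rw [mem_roots (map_ne_zero hP), IsRoot.def, eval_map_algebraMap] at ha
    exact ha
  have him : a.im = 0 := by
    rcases lt_trichotomy a.im 0 with hlt | heq | hgt
    · refine absurd ?_ (h ((starRingEnd ℂ) a) (by simpa using hlt))
      rw [aeval_conj, h0, map_zero]
    · exact heq
    · exact absurd h0 (h a hgt)
  exact ⟨a.re, Complex.ext (by simp) (by simp [him])⟩

/-- `|P|` increases when moving up from a point of the closed upper half plane, and when moving
up and to the right from a point of the closed first quadrant. -/
def NormMono (P : ℝ[X]) : Prop :=
  ∀ z w : ℂ, 0 ≤ z.im → z.im ≤ w.im → (z.re = w.re ∨ 0 ≤ z.re ∧ z.re ≤ w.re) →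
    ‖aeval z P‖ ≤ ‖aeval w P‖

theorem NormMono.mul {P Q : ℝ[X]} (hP : NormMono P) (hQ : NormMono Q) : NormMono (P * Q) := by
  intro z w h1 h2 h3
  rw [map_mul, map_mul, norm_mul, norm_mul]
  exact mul_le_mul (hP z w h1 h2 h3) (hQ z w h1 h2 h3) (norm_nonneg _) (norm_nonneg _)

theorem NormMono.C (c : ℝ) : NormMono (C c) := by
  intro z w _ _ _
  rw [aeval_C, aeval_C]

theorem NormMono.X_sub_C {r : ℝ} (hr : r ≤ 0) : NormMono (X - Polynomial.C r) := by
  intro z w h1 h2 h3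
  simp only [map_sub, aeval_X, aeval_C, Complex.coe_algebraMap]
  have him : (z - r).im ^ 2 ≤ (w - r).im ^ 2 := by
    simp only [Complex.sub_im, Complex.ofReal_im, sub_zero]
    nlinarith
  have hre : (z - r).re ^ 2 ≤ (w - r).re ^ 2 := by
    simp only [Complex.sub_re, Complex.ofReal_re]
    rcases h3 with h | h
    · rw [h]
    · nlinarith
  rw [← sq_le_sq₀ (norm_nonneg _) (norm_nonneg _), Complex.sq_norm, Complex.sq_norm,
    Complex.normSq_apply, Complex.normSq_apply]
  nlinarith

theorem NormMono.of_realRooted {P : ℝ[X]} (hP : RealRooted P) (hP0 : OnlyNonposRoots P) :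
    NormMono P := by
  rcases hP with rfl | hP
  · simpa using NormMono.C 0
  rw [← C_leadingCoeff_mul_prod_multiset_X_sub_C hP]
  refine (NormMono.C _).mul (Multiset.prod_induction _ _ (fun _ _ => NormMono.mul) ?_ ?_)
  · simpa using NormMono.C 1
  · intro p hp
    obtain ⟨r, hr, rfl⟩ := Multiset.mem_map.1 hp
    exact NormMono.X_sub_C (hP0 r hr)

theorem eq_zero_of_aeval_eq_zero {P : ℝ[X]} (f : ℝ → ℂ) (hf : Function.Injective f) {v : ℝ}
    (hv : 0 < v) (h : ∀ u : ℝ, 0 ≤ u → u ≤ v → aeval (f u) P = 0) : P = 0 := by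
  rw [← map_eq_zero_iff (mapRingHom (algebraMap ℝ ℂ))
    (map_injective _ (algebraMap ℝ ℂ).injective)]
  refine eq_zero_of_infinite_isRoot _ (((Set.Icc_infinite hv).image hf.injOn).mono ?_)
  rintro _ ⟨u, hu, rfl⟩
  rw [Set.mem_ofPred_eq, IsRoot.def, coe_mapRingHom, eval_map_algebraMap]
  exact h u hu.1 hu.2

theorem NormMono.realRooted {P : ℝ[X]} (h : NormMono P) : RealRooted P := by
  by_cases hP : P = 0
  · exact Or.inl hP
  refine Or.inr (card_roots_eq_of_aeval_ne_zero hP fun z hz h0 => hP ?_)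
  refine eq_zero_of_aeval_eq_zero (fun u => ⟨z.re, u⟩)
    (fun u v huv => congrArg Complex.im huv) hz fun u hu huz => ?_
  have := h ⟨z.re, u⟩ z hu huz (Or.inl rfl)
  rw [h0, norm_zero] at this
  exact norm_le_zero_iff.1 this

theorem NormMono.onlyNonposRoots {P : ℝ[X]} (h : NormMono P) : OnlyNonposRoots P := by
  intro x hx
  have hP : P ≠ 0 := ne_zero_of_mem_roots hx
  by_contra! hx0
  refine hP (eq_zero_of_aeval_eq_zero (fun u => (u : ℂ)) Complex.ofReal_injective hx0
    fun u hu hux => ?_)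
  have h0 : aeval (x : ℂ) P = 0 := by
    have := aeval_algebraMap_apply_eq_algebraMap_eval (A := ℂ) x P
    rw [(mem_roots hP).1 hx, map_zero] at this
    exact this
  have := h (u : ℂ) (x : ℂ) (by simp) (by simp) (Or.inr ⟨by simpa using hu, by simpa using hux⟩)
  rw [h0, norm_zero] at this
  exact norm_le_zero_iff.1 this

theorem NormMono.of_coeff_nonneg {P : ℝ[X]} (h : ∀ z : ℂ, 0 < z.im → aeval z P ≠ 0)
    (hc : ∀ k, 0 ≤ P.coeff k) : NormMono P := by
  by_cases hP : P = 0
  · rw [hP]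
    simpa using NormMono.C 0
  refine NormMono.of_realRooted (Or.inr (card_roots_eq_of_aeval_ne_zero hP h)) fun x hx => ?_
  by_contra! hx0
  have h0 := (mem_roots hP).1 hx
  rw [IsRoot.def, eval_eq_sum_range,
    Finset.sum_eq_zero_iff_of_nonneg fun k _ => mul_nonneg (hc k) (pow_nonneg hx0.le k)] at h0
  refine hP (leadingCoeff_eq_zero.1 ?_)
  have := h0 P.natDegree (Finset.self_mem_range_succ _)
  exact (mul_eq_zero.1 this).resolve_right (pow_pos hx0 _).ne'

section Limits

variable {ι : Type*} {l : Filter ι} {n : ℕ} {P Q : ι → ℝ[X]} {P₀ Q₀ : ℝ[X]}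

/-- Convergence of polynomials of degree at most `n`, coefficient by coefficient. -/
def TendstoCoeff (n : ℕ) (P : ι → ℝ[X]) (l : Filter ι) (P₀ : ℝ[X]) : Prop :=
  (∀ i, (P i).natDegree ≤ n) ∧ P₀.natDegree ≤ n ∧
    ∀ k, Tendsto (fun i => (P i).coeff k) l (nhds (P₀.coeff k))

theorem TendstoCoeff.aeval (h : TendstoCoeff n P l P₀) (z : ℂ) :
    Tendsto (fun i => aeval z (P i)) l (nhds (aeval z P₀)) := by
  have e : ∀ R : ℝ[X], R.natDegree ≤ n →
      Polynomial.aeval z R = ∑ k ∈ Finset.range (n + 1), (R.coeff k : ℂ) * z ^ k := by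
    intro R hR
    rw [aeval_eq_sum_range' (Nat.lt_succ_of_le hR)]
    simp only [Complex.real_smul]
  simp only [e _ (h.1 _), e _ h.2.1]
  exact tendsto_finsetSum _ fun k _ =>
    ((Complex.continuous_ofReal.tendsto _).comp (h.2.2 k)).mul_const _

theorem TendstoCoeff.normMono [l.NeBot] (h : TendstoCoeff n P l P₀)
    (hP : ∀ᶠ i in l, NormMono (P i)) : NormMono P₀ := by
  intro z w h1 h2 h3
  refine le_of_tendsto_of_tendsto (h.aeval z).norm (h.aeval w).norm ?_
  filter_upwards [hP] with i hi
  exact hi z w h1 h2 h3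

theorem TendstoCoeff.lowerIm [l.NeBot] (hP : TendstoCoeff n P l P₀) (hQ : TendstoCoeff n Q l Q₀)
    (h : ∀ᶠ i in l, LowerIm (P i) (Q i)) : LowerIm P₀ Q₀ := by
  intro z hz
  refine le_of_tendsto ((Complex.continuous_im.tendsto _).comp
    ((hQ.aeval z).mul ((Complex.continuous_conj.tendsto _).comp (hP.aeval z)))) ?_
  filter_upwards [h] with i hi
  exact hi z hz

end Limits

theorem continuous_coeff_prod {ι : Type*} (s : Finset ι) {u p : ι → ℝ → ℝ}
    (hu : ∀ i, Continuous (u i)) (hp : ∀ i, Continuous (p i)) (k : ℕ) :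
    Continuous fun ε => (∏ i ∈ s, (C (u i ε) * X + C (p i ε))).coeff k := by
  induction s using Finset.induction_on generalizing k with
  | empty => simpa using continuous_const
  | insert a s ha ih =>
    simp only [Finset.prod_insert ha, add_mul, coeff_add, mul_assoc, coeff_C_mul]
    cases k with
    | zero =>
      simp only [mul_coeff_zero, coeff_X_zero, zero_mul, mul_zero, zero_add]
      exact (hp a).mul (by simpa only [mul_coeff_zero] using ih 0)
    | succ k =>
      simp only [coeff_X_mul]
      exact ((hu a).mul (ih k)).add ((hp a).mul (ih (k + 1)))

theorem continuous_qBinom (n k : ℕ) : Continuous fun q => qBinom n k q := by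
  have := continuous_coeff_prod (Finset.range n) (u := fun j q => q ^ j) (p := fun _ _ => 1)
    (fun j => continuous_pow j) (fun _ => continuous_const) k
  simpa [qBinom, Rpoly, add_comm] using this

theorem tendstoCoeff_qHadamard {ι : Type*} {l : Filter ι} {n : ℕ} {r : ι → ℝ} {q : ℝ}
    (hq : 0 < q) (hr : Tendsto r l (nhds q)) {P Q : ι → ℝ[X]} {P₀ Q₀ : ℝ[X]}
    (hP : ∀ k, Tendsto (fun i => (P i).coeff k) l (nhds (P₀.coeff k)))
    (hQ : ∀ k, Tendsto (fun i => (Q i).coeff k) l (nhds (Q₀.coeff k))) :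
    TendstoCoeff n (fun i => qHadamard n (r i) (P i) (Q i)) l (qHadamard n q P₀ Q₀) := by
  refine ⟨fun i => natDegree_qHadamard_le _ _ _ _, natDegree_qHadamard_le _ _ _ _, fun k => ?_⟩
  simp only [qHadamard_coeff]
  rcases le_or_gt k n with h | h
  · exact ((hP k).mul (hQ k)).div (((continuous_qBinom n k).tendsto q).comp hr)
      (qBinom_pos hq h).ne'
  · simp only [qBinom_eq_zero _ h, div_zero]
    exact tendsto_const_nhds

/-- Leading coefficient of the `i`-th factor in the perturbation of a `q`-separated product. -/
noncomputable def perturbLead (q : ℝ) (d i : ℕ) (ε : ℝ) : ℝ :=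
  if i < d then (1 - ε) ^ i else ε * ((1 - ε) * q / 2) ^ i

/-- Constant coefficient of the `i`-th factor in the perturbation of a `q`-separated product. -/
noncomputable def perturbConst (q : ℝ) (d : ℕ) (t : ℕ → ℝ) (i : ℕ) (ε : ℝ) : ℝ :=
  if i < d then t i + ε * (2 / q) ^ i else 1

/-- A perturbation of `∏ i ∈ s with i < d, (X + C (t i))` by linear factors with strictly
`(1 - ε) q`-separated zeros. -/
noncomputable def perturb (q : ℝ) (d : ℕ) (t : ℕ → ℝ) (s : Finset ℕ) (ε : ℝ) : ℝ[X] :=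
  ∏ i ∈ s, (C (perturbLead q d i ε) * X + C (perturbConst q d t i ε))

theorem continuous_perturbLead (q : ℝ) (d i : ℕ) : Continuous (perturbLead q d i) := by
  unfold perturbLead
  split_ifs <;> fun_prop

theorem continuous_perturbConst (q : ℝ) (d : ℕ) (t : ℕ → ℝ) (i : ℕ) :
    Continuous (perturbConst q d t i) := by
  unfold perturbConst
  split_ifs <;> fun_prop

theorem perturb_zero (q : ℝ) (d : ℕ) (t : ℕ → ℝ) (s : Finset ℕ) :
    perturb q d t s 0 = ∏ i ∈ s with i < d, (X + C (t i)) := by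
  rw [Finset.prod_filter]
  refine Finset.prod_congr rfl fun i _ => ?_
  unfold perturbLead perturbConst
  split_ifs <;> simp

theorem tendsto_coeff_perturb (q : ℝ) (d : ℕ) (t : ℕ → ℝ) (s : Finset ℕ) (k : ℕ) :
    Tendsto (fun ε => (perturb q d t s ε).coeff k) (nhdsWithin 0 (Set.Ioi 0))
      (nhds ((∏ i ∈ s with i < d, (X + C (t i))).coeff k)) := by
  rw [← perturb_zero q]
  exact ((continuous_coeff_prod s (continuous_perturbLead q d)
    (continuous_perturbConst q d t) k).tendsto 0).mono_left nhdsWithin_le_nhds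

theorem perturbLead_pos {q : ℝ} (hq : 0 < q) {ε : ℝ} (h0 : 0 < ε) (h1 : ε < 1) (d i : ℕ) :
    0 < perturbLead q d i ε := by
  have : 0 < 1 - ε := by linarith
  unfold perturbLead
  split_ifs <;> positivity

theorem perturbConst_pos {q : ℝ} (hq : 0 < q) {d : ℕ} {t : ℕ → ℝ} (ht : ∀ i < d, 0 ≤ t i)
    {ε : ℝ} (h0 : 0 < ε) (i : ℕ) : 0 < perturbConst q d t i ε := by
  unfold perturbConst
  split_ifs with h
  · have := ht i h
    positivity
  · exact one_pos

theorem eventually_perturb_sep {q : ℝ} (hq : 0 < q) {d : ℕ} {t : ℕ → ℝ}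
    (hsep : ∀ i, i + 1 < d → t i ≤ q * t (i + 1)) (i : ℕ) :
    ∀ᶠ ε in nhdsWithin 0 (Set.Ioi 0), perturbConst q d t i ε * perturbLead q d (i + 1) ε <
      (1 - ε) * q * perturbConst q d t (i + 1) ε * perturbLead q d i ε := by
  have hev : ∀ᶠ ε : ℝ in nhdsWithin 0 (Set.Ioi 0), 0 < ε ∧ ε < 1 := by
    filter_upwards [Ioo_mem_nhdsGT (one_pos : (0 : ℝ) < 1)] with ε hε using hε
  rcases lt_trichotomy (i + 1) d with h | h | h
  · filter_upwards [hev] with ε ⟨h0, h1⟩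
    have hi : i < d := by omega
    simp only [perturbConst, perturbLead, if_pos h, if_pos hi]
    have e : q * (2 / q) ^ (i + 1) = 2 * (2 / q) ^ i := by
      rw [pow_succ]
      field_simp
    have : 0 < (2 / q) ^ i := by positivity
    have : t i + ε * (2 / q) ^ i < q * (t (i + 1) + ε * (2 / q) ^ (i + 1)) := by
      have := hsep i h
      have : 0 < ε * (2 / q) ^ i := by positivity
      nlinarith
    have hp : 0 < (1 - ε) ^ (i + 1) := pow_pos (by linarith) _
    calc _ < q * (t (i + 1) + ε * (2 / q) ^ (i + 1)) * (1 - ε) ^ (i + 1) :=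
          mul_lt_mul_of_pos_right this hp
      _ = _ := by ring
  · have hlim : ∀ f : ℝ → ℝ, Continuous f →
        Tendsto f (nhdsWithin 0 (Set.Ioi 0)) (nhds (f 0)) :=
      fun f hf => (hf.tendsto 0).mono_left nhdsWithin_le_nhds
    refine (hlim _ ((continuous_perturbConst q d t i).mul
      (continuous_perturbLead q d (i + 1)))).eventually_lt
      (hlim (fun ε => (1 - ε) * q * perturbConst q d t (i + 1) ε * perturbLead q d i ε)
        ((((continuous_const.sub continuous_id).mul continuous_const).mul
          (continuous_perturbConst q d t (i + 1))).mul (continuous_perturbLead q d i))) ?_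
    have hi : i < d := by omega
    simp [perturbConst, perturbLead, h, hi, hq]
  · filter_upwards [hev] with ε ⟨h0, h1⟩
    have hi : ¬ i < d := by omega
    have hi' : ¬ i + 1 < d := by omega
    simp only [perturbConst, perturbLead, if_neg hi, if_neg hi']
    have h2 : 0 < (1 - ε) * q := mul_pos (by linarith) hq
    have : 0 < ε * ((1 - ε) * q / 2) ^ i := by positivity
    rw [pow_succ]
    nlinarith

theorem strictSep_image {q : ℝ} (hq1 : q ≤ 1) {n : ℕ} {r : ℕ → ℝ}
    (hr : ∀ i, 0 < r i) (hsep : ∀ i < n, r i < q * r (i + 1)) :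
    Set.InjOn r (Finset.range n) ∧ StrictSep q ((Finset.range n).image r) := by
  have key : ∀ i j, i < j → j < n → r i < q * r j := by
    intro i j hij
    induction j, hij using Nat.le_induction with
    | base => intro hj; exact hsep i (by omega)
    | succ j hj ih =>
      intro hjn
      have := ih (by omega)
      have := hsep j (by omega)
      have := hr j
      nlinarith
  have hlt : ∀ i j, i < j → j < n → r i < r j := fun i j hij hj => by
    have := key i j hij hj
    have := hr j
    nlinarith
  refine ⟨fun i hi j hj hij => ?_, ?_, ?_⟩
  · have hi := Finset.mem_range.1 hi
    have hj := Finset.mem_range.1 hj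
    rcases lt_trichotomy i j with h | h | h
    · exact absurd hij (hlt i j h hj).ne
    · exact h
    · exact absurd hij (hlt j i h hi).ne'
  · simp only [Finset.mem_image, forall_exists_index, and_imp, forall_apply_eq_imp_iff₂]
    exact fun i _ => hr i
  · simp only [Finset.mem_image, Finset.mem_range, forall_exists_index, and_imp,
      forall_apply_eq_imp_iff₂]
    intro i hi j hj hij
    refine key i j ?_ hj
    by_contra! h
    rcases h.eq_or_lt with h | h
    · rw [h] at hij
      exact lt_irrefl _ hij
    · exact lt_asymm hij (hlt j i h hi)

theorem prod_linear_eq {s : Finset ℕ} {u p : ℕ → ℝ} (hu : ∀ i, u i ≠ 0)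
    (hinj : Set.InjOn (fun i => p i / u i) s) :
    ∏ i ∈ s, (C (u i) * X + C (p i)) =
      C (∏ i ∈ s, u i) * rootProd (s.image fun i => p i / u i) := by
  rw [rootProd, Finset.prod_image hinj, map_prod, ← Finset.prod_mul_distrib]
  refine Finset.prod_congr rfl fun i _ => ?_
  rw [mul_add, ← C_mul, mul_div_cancel₀ _ (hu i)]

theorem LowerIm.C_mul_left {S P : ℝ[X]} {c : ℝ} (hc : 0 ≤ c) (h : LowerIm S P) :
    LowerIm (C c * S) P := by
  intro z hz
  have := h z hz
  have e : aeval z P * (starRingEnd ℂ) (aeval z (C c * S))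
      = c * (aeval z P * (starRingEnd ℂ) (aeval z S)) := by
    rw [map_mul, aeval_C, Complex.coe_algebraMap, map_mul, Complex.conj_ofReal]
    ring
  rw [e, Complex.im_ofReal_mul]
  nlinarith

theorem C_mul_qHadamard (n : ℕ) (q a : ℝ) (F G : ℝ[X]) :
    qHadamard n q (C a * F) G = C a * qHadamard n q F G := by
  rw [qHadamard_comm, qHadamard_C_mul, qHadamard_comm]

theorem eventually_perturb {q : ℝ} (hq0 : 0 < q) (hq1 : q ≤ 1) {n d e : ℕ} {t v : ℕ → ℝ}
    (ht : ∀ i < d, 0 ≤ t i) (htsep : ∀ i, i + 1 < d → t i ≤ q * t (i + 1))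
    (hv : ∀ i < e, 0 ≤ v i) (hvsep : ∀ i, i + 1 < e → v i ≤ q * v (i + 1)) :
    ∀ᶠ ε in nhdsWithin 0 (Set.Ioi 0),
      NormMono (qHadamard n ((1 - ε) * q) (perturb q d t (Finset.range n) ε)
        (perturb q e v (Finset.range n) ε)) ∧
      ∀ j < n, LowerIm (qHadamard n ((1 - ε) * q) (perturb q d t (Finset.range n) ε)
        (perturb q e v (Finset.range n) ε))
        (qHadamard n ((1 - ε) * q) (perturb q d t (Finset.range n) ε)
        (perturb q e v ((Finset.range n).erase j) ε)) := by
  filter_upwards [Ioo_mem_nhdsGT (one_pos : (0 : ℝ) < 1),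
    (eventually_all_finset (Finset.range n)).2 fun i _ => eventually_perturb_sep hq0 htsep i,
    (eventually_all_finset (Finset.range n)).2 fun i _ => eventually_perturb_sep hq0 hvsep i]
    with ε ⟨h0, h1⟩ hsep1 hsep2
  have hqε : 0 < (1 - ε) * q := mul_pos (by linarith) hq0
  have hqε1 : (1 - ε) * q < 1 := by nlinarith
  have aux : ∀ (d : ℕ) (t : ℕ → ℝ), (∀ i < d, 0 ≤ t i) →
      (∀ i ∈ Finset.range n, perturbConst q d t i ε * perturbLead q d (i + 1) ε <
        (1 - ε) * q * perturbConst q d t (i + 1) ε * perturbLead q d i ε) →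
      ∃ r : ℕ → ℝ, Set.InjOn r (Finset.range n) ∧
        StrictSep ((1 - ε) * q) ((Finset.range n).image r) ∧
        ∀ s ⊆ Finset.range n, ∃ c, 0 < c ∧ perturb q d t s ε = C c * rootProd (s.image r) := by
    intro d t ht hsep
    have hu := perturbLead_pos hq0 h0 h1 d
    have hp := perturbConst_pos hq0 ht h0
    obtain ⟨hinj, hS⟩ := strictSep_image (n := n) hqε1.le
      (r := fun i => perturbConst q d t i ε / perturbLead q d i ε)
      (fun i => div_pos (hp i) (hu i)) (fun i hi => by
        have := hsep i (Finset.mem_range.2 hi)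
        rw [← mul_div_assoc, div_lt_div_iff₀ (hu i) (hu (i + 1))]
        exact this)
    refine ⟨_, hinj, hS, fun s hs =>
      ⟨∏ i ∈ s, perturbLead q d i ε, Finset.prod_pos fun i _ => hu i, ?_⟩⟩
    exact prod_linear_eq (u := fun i => perturbLead q d i ε)
      (p := fun i => perturbConst q d t i ε) (fun i => (hu i).ne') (hinj.mono (Finset.coe_subset.2 hs))
  obtain ⟨r1, hinj1, hs1, hprod1⟩ := aux d t ht hsep1
  obtain ⟨r2, hinj2, hs2, hprod2⟩ := aux e v hv hsep2
  obtain ⟨c1, hc1, e1⟩ := hprod1 _ subset_rfl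
  obtain ⟨c2, hc2, e2⟩ := hprod2 _ subset_rfl
  have hcard1 : ((Finset.range n).image r1).card = n := by
    rw [Finset.card_image_of_injOn hinj1, Finset.card_range]
  have hcard2 : ((Finset.range n).image r2).card = n := by
    rw [Finset.card_image_of_injOn hinj2, Finset.card_range]
  obtain ⟨hne, hst⟩ := qHadamard_rootProd_stieltjes hqε hqε1 n hs1 hs2 hcard1 hcard2
  have hC : ∀ c : ℝ, 0 < c → ∀ z : ℂ, aeval z (C c) ≠ 0 := fun c hc z => by
    simpa using hc.ne'
  rw [e1, e2]
  simp only [C_mul_qHadamard, qHadamard_C_mul]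
  refine ⟨(NormMono.C _).mul ((NormMono.C _).mul (NormMono.of_coeff_nonneg hne fun k => ?_)),
    fun j hj => ?_⟩
  · rw [qHadamard_coeff]
    rcases le_or_gt k n with h | h
    · exact div_nonneg (mul_nonneg (coeff_rootProd_pos hs1.1 (h.trans_eq hcard1.symm)).le
        (coeff_rootProd_pos hs2.1 (h.trans_eq hcard2.symm)).le) (qBinom_nonneg hqε _ _)
    · rw [qBinom_eq_zero _ h, div_zero]
  · obtain ⟨c3, hc3, e3⟩ := hprod2 _ (Finset.erase_subset j _)
    have himg : ((Finset.range n).erase j).image r2 = ((Finset.range n).image r2).erase (r2 j) := by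
      ext x
      simp only [Finset.mem_image, Finset.mem_erase, Finset.mem_range]
      constructor
      · rintro ⟨i, ⟨hij, hi⟩, rfl⟩
        exact ⟨fun h => hij (hinj2 (by simpa using hi) (by simpa using hj) h), i, hi, rfl⟩
      · rintro ⟨hne, i, hi, rfl⟩
        exact ⟨i, ⟨fun h => hne (h ▸ rfl), hi⟩, rfl⟩
    rw [e3, himg, qHadamard_C_mul]
    exact ((((hst (r2 j) (Finset.mem_image_of_mem r2 (Finset.mem_range.2 hj))).1.C_mul
      hc3.le).C_mul hc1.le).C_mul_left hc1.le).C_mul_left hc2.le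

theorem LowerIm.C_mul_C_mul {S P : ℝ[X]} (h : LowerIm S P) (c : ℝ) :
    LowerIm (C c * S) (C c * P) := by
  intro z hz
  have := h z hz
  have e : aeval z (C c * P) * (starRingEnd ℂ) (aeval z (C c * S))
      = (c ^ 2 : ℝ) * (aeval z P * (starRingEnd ℂ) (aeval z S)) := by
    simp only [map_mul, aeval_C, Complex.coe_algebraMap, Complex.conj_ofReal, Complex.ofReal_pow]
    ring
  rw [e, Complex.im_ofReal_mul]
  exact mul_nonpos_of_nonneg_of_nonpos (sq_nonneg c) this

theorem exists_factorization {n : ℕ} {q : ℝ} (hq0 : 0 < q) {F : ℝ[X]} (hF : memNbar n q F)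
    (hF0 : F ≠ 0) :
    ∃ (d : ℕ) (t : ℕ → ℝ), d ≤ n ∧ (∀ i < d, 0 ≤ t i) ∧
      (∀ i, i + 1 < d → t i ≤ q * t (i + 1)) ∧
      F = C F.leadingCoeff * ∏ i ∈ Finset.range d, (X + C (t i)) := by
  obtain ⟨⟨hdeg, hreal, hmult, hsep⟩, hneg⟩ := hF
  replace hreal := hreal.resolve_left hF0
  set L := (F.roots.map Neg.neg).sort (· ≤ ·) with hL
  have hLmul : (L : Multiset ℝ) = F.roots.map Neg.neg := Multiset.sort_eq _ _
  have hlen : L.length = F.natDegree := by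
    rw [← hreal, ← Multiset.coe_card, hLmul, Multiset.card_map]
  have hmem : ∀ {x}, x ∈ L → -x ∈ F.roots := by
    intro x hx
    rw [← Multiset.mem_coe, hLmul] at hx
    obtain ⟨y, hy, rfl⟩ := Multiset.mem_map.1 hx
    rwa [neg_neg]
  have hget : ∀ i (hi : i < L.length), L.getD i 0 = L[i] := fun i hi => by simp [hi]
  refine ⟨L.length, fun i => L.getD i 0, hlen.trans_le hdeg, fun i hi => ?_, fun i hi => ?_, ?_⟩
  · simp only [hget i hi]
    have := hneg _ (hmem (List.getElem_mem hi))
    linarith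
  · have hi' : i < L.length := by omega
    simp only [hget i hi', hget (i + 1) hi]
    have hle : L[i] ≤ L[i + 1] :=
      (List.pairwise_iff_getElem.1 (Multiset.pairwise_sort _ _)) i (i + 1) hi' hi (by omega)
    have h0 : 0 ≤ L[i] := by
      have := hneg _ (hmem (List.getElem_mem hi'))
      linarith
    rcases h0.eq_or_lt with h0 | h0
    · rw [← h0] at hle ⊢
      positivity
    rcases hle.eq_or_lt with heq | hlt
    · have hdup : 2 ≤ L.count L[i] := by
        rw [← List.duplicate_iff_two_le_count, List.duplicate_iff_exists_distinct_get]
        exact ⟨⟨i, hi'⟩, ⟨i + 1, hi⟩, by simp, rfl, heq⟩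
      have hq := hmult (-L[i]) (hmem (List.getElem_mem hi')) (by linarith) (by
        rwa [← Multiset.coe_count, hLmul, ← neg_neg L[i],
          Multiset.count_map_eq_count' _ _ neg_injective] at hdup)
      rw [← heq]
      nlinarith
    · have := hsep (-L[i]) (hmem (List.getElem_mem hi')) (-L[i + 1]) (hmem (List.getElem_mem hi))
        (Or.inl ⟨by linarith, by linarith⟩)
      rwa [neg_div_neg_eq, div_le_iff₀ (by linarith)] at this
  · conv_lhs => rw [← C_leadingCoeff_mul_prod_multiset_X_sub_C hreal]
    congr 1
    have e1 : F.roots.map (fun a => X - C a) = (F.roots.map Neg.neg).map (fun a => X + C a) := by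
      rw [Multiset.map_map]
      refine Multiset.map_congr rfl fun x _ => ?_
      simp [sub_eq_add_neg]
    rw [e1, ← hLmul, Multiset.map_coe, Multiset.prod_coe, ← Fin.prod_univ_fun_getElem,
      Finset.prod_range]
    refine Finset.prod_congr rfl fun i _ => ?_
    exact congrArg (fun x => X + C x) (hget i i.2).symm

/-- The main closed result: the product of elements of `𝓝̄_n(q)` has only nonpositive zeros, and
removing a zero from one factor interlaces. -/
theorem qHadamard_closed {n : ℕ} {q : ℝ} (hq0 : 0 < q) (hq1 : q ≤ 1) {F G : ℝ[X]}
    (hF : memNbar n q F) (hG : memNbar n q G) :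
    NormMono (qHadamard n q F G) ∧ ∀ (a : ℝ) (K : ℝ[X]), G = (X + C a) * K →
      LowerIm (qHadamard n q F G) (qHadamard n q F K) := by
  have hzero : ∀ H : ℝ[X], qHadamard n q F 0 = 0 ∧ qHadamard n q 0 H = 0 := fun H =>
    ⟨by ext; simp [qHadamard_coeff], by ext; simp [qHadamard_coeff]⟩
  have h0 : NormMono 0 := by simpa using NormMono.C 0
  by_cases hF0 : F = 0
  · subst hF0
    simp only [(hzero _).2]
    exact ⟨h0, fun _ _ _ => LowerIm.zero 0⟩
  by_cases hG0 : G = 0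
  · subst hG0
    rw [(hzero 0).1]
    refine ⟨h0, fun a K h => ?_⟩
    have : K = 0 := (mul_eq_zero.1 h.symm).resolve_left (monic_X_add_C a).ne_zero
    rw [this, (hzero 0).1]
    exact LowerIm.zero 0
  obtain ⟨d, t, hdn, ht, htsep, hFe⟩ := exists_factorization hq0 hF hF0
  obtain ⟨e, v, hen, hv, hvsep, hGe⟩ := exists_factorization hq0 hG hG0
  set cF := F.leadingCoeff
  set cG := G.leadingCoeff
  have hcG : cG ≠ 0 := leadingCoeff_ne_zero.2 hG0
  have hfilter : ∀ {m : ℕ}, m ≤ n → (Finset.range n).filter (· < m) = Finset.range m := by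
    intro m hm
    ext i
    simp only [Finset.mem_filter, Finset.mem_range]
    omega
  have hqlim : Tendsto (fun ε : ℝ => (1 - ε) * q) (nhdsWithin 0 (Set.Ioi 0)) (nhds q) := by
    have : Tendsto (fun ε : ℝ => (1 - ε) * q) (nhds 0) (nhds ((1 - 0) * q)) :=
      Continuous.tendsto (by fun_prop) 0
    rw [sub_zero, one_mul] at this
    exact this.mono_left nhdsWithin_le_nhds
  have hev := eventually_perturb (n := n) hq0 hq1 ht htsep hv hvsep
  have hFlim := tendsto_coeff_perturb q d t (Finset.range n)
  rw [hfilter hdn] at hFlim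
  have hlim := tendstoCoeff_qHadamard (n := n) hq0 hqlim hFlim
    (tendsto_coeff_perturb q e v (Finset.range n))
  rw [hfilter hen] at hlim
  set A := ∏ i ∈ Finset.range d, (X + C (t i)) with hA
  set B := ∏ i ∈ Finset.range e, (X + C (v i)) with hB
  rw [hFe, hGe]
  simp only [C_mul_qHadamard, qHadamard_C_mul]
  refine ⟨(NormMono.C _).mul ((NormMono.C _).mul (hlim.normMono (hev.mono fun ε h => h.1))),
    fun a K hK => ?_⟩
  have hroot : B.eval (-a) = 0 := by
    have := congrArg (eval (-a)) hK
    rw [eval_mul, eval_mul, eval_C, eval_add, eval_X, eval_C, neg_add_cancel, zero_mul] at this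
    exact (mul_eq_zero.1 this).resolve_left hcG
  rw [hB, eval_prod, Finset.prod_eq_zero_iff] at hroot
  obtain ⟨j, hj, hja⟩ := hroot
  have hja : v j = a := by
    rw [eval_add, eval_X, eval_C] at hja
    linarith
  have hj' := Finset.mem_range.1 hj
  have hKe : K = C cG * ∏ i ∈ (Finset.range e).erase j, (X + C (v i)) := by
    refine mul_left_cancel₀ (monic_X_add_C a).ne_zero ?_
    rw [← hK, hB, ← Finset.mul_prod_erase _ _ hj, hja]
    ring
  have hKlim := tendstoCoeff_qHadamard (n := n) hq0 hqlim hFlim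
    (tendsto_coeff_perturb q e v ((Finset.range n).erase j))
  rw [Finset.filter_erase, hfilter hen] at hKlim
  have hmain := hlim.lowerIm hKlim (hev.mono fun ε h => h.2 j (hj'.trans_le hen))
  rw [hKe, qHadamard_C_mul, mul_left_comm (C cF)]
  exact (hmain.C_mul_C_mul cF).C_mul_C_mul cG

theorem memN.memNbar {n : ℕ} {q : ℝ} {F : ℝ[X]} (h : memN n q F) : memNbar n q F :=
  ⟨⟨h.1.1, h.1.2.1, fun x hx h0 h2 => (h.1.2.2.1 x hx h0 h2).le,
    fun x hx y hy hxy => (h.1.2.2.2 x hx y hy hxy).le⟩, h.2⟩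

theorem memN_zero (n : ℕ) (q : ℝ) : memN n q 0 := by
  simp [memN, memR, RealRooted, StrictLogSep, OnlyNonposRoots]

theorem exists_strict_factorization {n : ℕ} {q : ℝ} (hq1 : q ≤ 1) {G : ℝ[X]} (hG : memN n q G)
    (hG0 : G ≠ 0) :
    ∃ (c : ℝ) (r : ℕ) (s : Finset ℝ), c ≠ 0 ∧ r + s.card ≤ n ∧ StrictSep q s ∧
      G = C c * (X ^ r * rootProd s) := by
  obtain ⟨⟨hdeg, hreal, hmult, hsep⟩, hneg⟩ := hG
  replace hreal := hreal.resolve_left hG0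
  set T := G.roots.toFinset.erase 0 with hT
  have hTmem : ∀ x ∈ T, x ∈ G.roots ∧ x < 0 := by
    intro x hx
    obtain ⟨h0, hx⟩ := Finset.mem_erase.1 hx
    have hx := Multiset.mem_toFinset.1 hx
    exact ⟨hx, lt_of_le_of_ne (hneg x hx) h0⟩
  have hfac : G = C G.leadingCoeff * (X ^ (G.roots.count 0) * rootProd (T.image Neg.neg)) := by
    conv_lhs => rw [← C_leadingCoeff_mul_prod_multiset_X_sub_C hreal]
    congr 1
    have h1 : rootProd (T.image Neg.neg) = ∏ x ∈ T, (X - C x) ^ G.roots.count x := by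
      rw [rootProd, Finset.prod_image neg_injective.injOn]
      refine Finset.prod_congr rfl fun x hx => ?_
      obtain ⟨hx, hx0⟩ := hTmem x hx
      have : G.roots.count x = 1 := by
        have h1 := Multiset.one_le_count_iff_mem.2 hx
        by_contra hne
        have := hmult x hx hx0.ne (by omega)
        linarith
      rw [this, pow_one, C_neg, sub_eq_add_neg]
    have h2 : (X : ℝ[X]) ^ (G.roots.count 0) = (X - C 0) ^ (G.roots.count 0) := by simp
    rw [Finset.prod_multiset_map_count, h1, h2]
    by_cases h0 : (0 : ℝ) ∈ G.roots.toFinset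
    · exact (Finset.mul_prod_erase _ (fun x => (X - C x) ^ G.roots.count x) h0).symm
    · have : G.roots.count 0 = 0 :=
        Multiset.count_eq_zero.2 fun h => h0 (Multiset.mem_toFinset.2 h)
      rw [this, pow_zero, one_mul, hT, Finset.erase_eq_of_notMem h0]
  refine ⟨G.leadingCoeff, G.roots.count 0, T.image Neg.neg, leadingCoeff_ne_zero.2 hG0, ?_,
    ⟨?_, ?_⟩, hfac⟩
  · have := congrArg natDegree hfac
    rw [natDegree_C_mul (leadingCoeff_ne_zero.2 hG0), (monic_X_pow _).natDegree_mul
      (rootProd_monic _), natDegree_X_pow, natDegree_rootProd] at this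
    omega
  · intro x hx
    obtain ⟨y, hy, rfl⟩ := Finset.mem_image.1 hx
    have := (hTmem y hy).2
    linarith
  · intro x hx y hy hxy
    obtain ⟨a, ha, rfl⟩ := Finset.mem_image.1 hx
    obtain ⟨b, hb, rfl⟩ := Finset.mem_image.1 hy
    obtain ⟨ha, ha0⟩ := hTmem a ha
    obtain ⟨hb, hb0⟩ := hTmem b hb
    have := hsep a ha b hb (Or.inl ⟨by linarith, ha0⟩)
    rw [div_lt_iff_of_neg hb0] at this
    linarith

theorem mul_partialFraction (s : Finset ℝ) (D A : ℝ[X]) (a : ℝ) (w : ℝ → ℝ) (B : ℝ → ℝ[X]) :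
    D * (C a * A + ∑ x ∈ s, C (w x) * B x) = C a * (D * A) + ∑ x ∈ s, C (w x) * (D * B x) := by
  simp only [mul_add, Finset.mul_sum, mul_left_comm D]

theorem exists_comp_eq {q ρ : ℝ} (hqρ : q ≤ ρ) (hρ : ρ < 1) {s : Finset ℝ}
    (hs : StrictSep q s) (c : ℝ) (r : ℕ) :
    ∃ w : ℝ → ℝ, (∀ x ∈ s, 0 < w x) ∧
      (C c * (X ^ r * rootProd s)).comp (C ρ * X) =
        C (ρ ^ r) * (C (ρ ^ s.card) * (C c * (X ^ r * rootProd s)) +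
          ∑ x ∈ s, C (w x) * (C c * (X ^ r * rootProd (s.erase x)))) := by
  set H := (rootProd s).comp (C ρ * X) with hH
  have hHdeg : H.natDegree ≤ s.card := by
    rw [natDegree_le_iff_coeff_eq_zero]
    intro k hk
    rw [hH, comp_C_mul_X_coeff, coeff_eq_zero_of_natDegree_lt (by rwa [natDegree_rootProd]),
      zero_mul]
  have hHlead : H.coeff s.card = ρ ^ s.card := by
    have := (rootProd_monic s).coeff_natDegree
    rw [natDegree_rootProd] at this
    rw [hH, comp_C_mul_X_coeff, this, one_mul]
  refine ⟨fun x => H.eval (-x) / ∏ y ∈ s.erase x, (y - x), fun x hx => ?_, ?_⟩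
  · have hx0 := hs.1 x hx
    change 0 < H.eval (-x) / _
    rw [hH, eval_comp, eval_mul, eval_C, eval_X, eval_rootProd, ← Finset.mul_prod_erase _ _ hx,
      mul_div_assoc, ← Finset.prod_div_distrib]
    refine mul_pos (by nlinarith) (Finset.prod_pos fun y hy => ?_)
    obtain ⟨hyx, hy⟩ := Finset.mem_erase.1 hy
    rcases lt_or_gt_of_ne hyx with h | h
    · have := hs.2 y hy x hx h
      exact div_pos_of_neg_of_neg (by nlinarith) (by linarith)
    · exact div_pos (by nlinarith) (by linarith)
  · have e := eq_partialFraction s H hHdeg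
    rw [hHlead] at e
    rw [mul_comp, C_comp, mul_comp, X_pow_comp, ← hH, mul_pow, ← C_pow,
      mul_assoc (C (ρ ^ r)), mul_left_comm (C c), ← mul_assoc (C c)]
    simp only [← mul_assoc (C c)]
    rw [← mul_partialFraction, ← e]

theorem qHadamard_X_pow (n : ℕ) (q : ℝ) (F : ℝ[X]) (m : ℕ) :
    qHadamard n q F (X ^ m) = C (F.coeff m / qBinom n m q) * X ^ m := by
  ext k
  rw [qHadamard_coeff, coeff_C_mul, coeff_X_pow]
  split_ifs with h
  · rw [h, mul_one, mul_one]
  · simp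

/-- At a nonzero zero of `F * G`, not all of the products of `F` with `G` deprived of a zero can
vanish. -/
theorem exists_eval_qHadamard_ne_zero {n : ℕ} {q : ℝ} (hq0 : 0 < q) (F : ℝ[X]) {c : ℝ}
    (hc : c ≠ 0) {r : ℕ} {s : Finset ℝ} (hrs : r + s.card ≤ n)
    (hS : qHadamard n q F (C c * (X ^ r * rootProd s)) ≠ 0) {y : ℝ} (hy : y ≠ 0)
    (hSy : (qHadamard n q F (C c * (X ^ r * rootProd s))).eval y = 0) :
    ∃ x ∈ s, (qHadamard n q F (C c * (X ^ r * rootProd (s.erase x)))).eval y ≠ 0 := by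
  by_contra! hV
  have hcoeff : ∀ k ≤ s.card, F.coeff (r + k) = 0 := by
    intro k hk
    have h1 := eq_partialFraction s (X ^ k) (by rwa [natDegree_X_pow])
    have h2 : qHadamard n q F (C c * (X ^ r * X ^ k)) =
        C ((X ^ k : ℝ[X]).coeff s.card) * qHadamard n q F (C c * (X ^ r * rootProd s)) +
        ∑ x ∈ s, C ((X ^ k : ℝ[X]).eval (-x) / ∏ y ∈ s.erase x, (y - x)) *
          qHadamard n q F (C c * (X ^ r * rootProd (s.erase x))) := by
      simp only [← qHadamard_C_mul, ← qHadamard_sum, ← qHadamard_add, ← mul_assoc (C c)]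
      rw [← mul_partialFraction, ← h1]
    have h3 := congrArg (eval y) h2
    rw [eval_add, eval_mul, hSy, mul_zero, eval_finsetSum, Finset.sum_eq_zero fun x hx => by
      rw [eval_mul, hV x hx, mul_zero], ← pow_add, qHadamard_C_mul, qHadamard_X_pow] at h3
    have hq := (qBinom_pos hq0 (show r + k ≤ n by omega)).ne'
    simpa [hc, hy, hq] using h3
  refine hS (Polynomial.ext fun m => ?_)
  rw [qHadamard_coeff, coeff_C_mul, coeff_X_pow_mul', coeff_zero]
  split_ifs with h
  · rcases le_or_gt (m - r) s.card with h2 | h2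
    · have := hcoeff (m - r) h2
      rw [Nat.add_sub_cancel' h] at this
      rw [this, zero_mul, zero_div]
    · rw [coeff_eq_zero_of_natDegree_lt (p := rootProd s) (by rwa [natDegree_rootProd])]
      simp
  · simp

theorem memN_qHadamard {n : ℕ} {q : ℝ} (hq0 : 0 < q) (hq1 : q ≤ 1) {F G : ℝ[X]}
    (hF : memNbar n q F) (hG : memN n q G) : memN n q (qHadamard n q F G) := by
  by_cases hS : qHadamard n q F G = 0
  · rw [hS]
    exact memN_zero n q
  have hG0 : G ≠ 0 := by
    rintro rfl
    exact hS (by ext; simp [qHadamard_coeff])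
  obtain ⟨hmono, hlow⟩ := qHadamard_closed hq0 hq1 hF hG.memNbar
  obtain ⟨c, r, s, hc, hrs, hs, rfl⟩ := exists_strict_factorization hq1 hG hG0
  set G := C c * (X ^ r * rootProd s) with hGdef
  set S := qHadamard n q F G with hSdef
  set V : ℝ → ℝ → ℝ :=
    fun y x => (qHadamard n q F (C c * (X ^ r * rootProd (s.erase x)))).eval y with hV
  have hor : ∀ y, S.eval y = 0 → ∀ x ∈ s,
      (derivative S).eval y ≠ 0 ∧ 0 ≤ (derivative S).eval y * V y x ∨ V y x = 0 := by
    intro y hy x hx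
    refine (hlow x _ ?_).deriv_mul_nonneg_or hS hy
    rw [hGdef, ← X_add_C_mul_rootProd_erase hx]
    ring
  have hex : ∀ y, S.eval y = 0 → y ≠ 0 → ∃ x ∈ s, 0 < (derivative S).eval y * V y x := by
    intro y hy hy0
    obtain ⟨x, hx, hne⟩ := exists_eval_qHadamard_ne_zero hq0 F hc hrs hS hy0 hy
    obtain ⟨h1, h2⟩ := (hor y hy x hx).resolve_right hne
    exact ⟨x, hx, h2.lt_of_ne' (mul_ne_zero h1 hne)⟩
  have hroot : ∀ {y}, y ∈ S.roots → S.eval y = 0 := fun h => (mem_roots hS).1 h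
  refine ⟨⟨natDegree_qHadamard_le _ _ _ _, hmono.realRooted, fun y hy hy0 h2 => ?_,
    fun x hx y hy hxy => ?_⟩, hmono.onlyNonposRoots⟩
  · obtain ⟨x, hx, hpos⟩ := hex y (hroot hy) hy0
    rw [count_roots] at h2
    have := ((one_lt_rootMultiplicity_iff_isRoot hS).1 h2).2
    rw [IsRoot.def] at this
    simp [this] at hpos
  · obtain ⟨hyx, hx0⟩ : y < x ∧ x < 0 :=
      hxy.resolve_right fun h => absurd (hmono.onlyNonposRoots x hx) (not_le.2 h.1)
    have hy0 : y < 0 := hyx.trans hx0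
    by_contra! hge
    have hlt : x / y < 1 := (div_lt_one_of_neg hy0).2 hyx
    set ρ := x / y with hρ
    obtain ⟨w, hw, hcomp⟩ := exists_comp_eq hge hlt hs c r
    have h1 : (S.comp (C ρ * X)).eval y = 0 := by
      rw [eval_comp, eval_mul, eval_C, eval_X, hρ, div_mul_cancel₀ _ hy0.ne]
      exact hroot hx
    rw [hSdef, ← qHadamard_comp, hcomp, qHadamard_C_mul, qHadamard_add, qHadamard_C_mul,
      qHadamard_sum, ← hGdef, ← hSdef, eval_mul, eval_add, eval_mul, hroot hy, mul_zero, zero_add,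
      eval_finsetSum, eval_C] at h1
    have hρ0 : 0 < ρ := hq0.trans_le hge
    have h2 := (mul_eq_zero.1 h1).resolve_left (pow_pos hρ0 r).ne'
    have h3 : ∑ x ∈ s, w x * ((derivative S).eval y * V y x) = 0 := by
      rw [← mul_zero ((derivative S).eval y), ← h2, Finset.mul_sum]
      refine Finset.sum_congr rfl fun x _ => ?_
      rw [qHadamard_C_mul, eval_mul, eval_C]
      ring
    obtain ⟨x', hx', hpos⟩ := hex y (hroot hy) hy0.ne
    have h4 : 0 < ∑ x ∈ s, w x * ((derivative S).eval y * V y x) := by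
      refine Finset.sum_pos' (fun x hx => mul_nonneg (hw x hx).le ?_)
        ⟨x', hx', mul_pos (hw x' hx') hpos⟩
      rcases hor y (hroot hy) x hx with h | h
      · exact h.2
      · rw [h, mul_zero]
    exact h4.ne' h3

theorem roots_rootProd (s : Finset ℝ) : (rootProd s).roots = s.val.map Neg.neg := by
  have : rootProd s = ((s.val.map Neg.neg).map fun a => X - C a).prod := by
    rw [Multiset.map_map, rootProd, Finset.prod]
    refine congrArg _ (Multiset.map_congr rfl fun x _ => ?_)
    simp [sub_eq_add_neg]
  rw [this, roots_multiset_prod_X_sub_C]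

theorem memN_C_mul_rootProd {n : ℕ} {q : ℝ} {s : Finset ℝ} (hs : StrictSep q s)
    (hn : s.card ≤ n) {c : ℝ} (hc : c ≠ 0) : memN n q (C c * rootProd s) := by
  have hdeg : (C c * rootProd s).natDegree = s.card := by
    rw [natDegree_C_mul hc, natDegree_rootProd]
  have hroots : (C c * rootProd s).roots = s.val.map Neg.neg := by
    rw [roots_C_mul _ hc, roots_rootProd]
  have hmem : ∀ {x}, x ∈ (C c * rootProd s).roots → -x ∈ s := by
    intro x hx
    rw [hroots] at hx
    obtain ⟨y, hy, rfl⟩ := Multiset.mem_map.1 hx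
    rwa [neg_neg]
  refine ⟨⟨hdeg.trans_le hn, Or.inr ?_, fun x hx _ h2 => ?_, fun x hx y hy hxy => ?_⟩,
    fun x hx => ?_⟩
  · rw [hdeg, hroots, Multiset.card_map, Finset.card_val]
  · have := Multiset.nodup_iff_count_le_one.1 (s.nodup.map neg_injective) x
    rw [hroots] at h2
    omega
  · have hx0 := hs.1 _ (hmem hx)
    have hy0 := hs.1 _ (hmem hy)
    rcases hxy with h | h
    · have := hs.2 _ (hmem hx) _ (hmem hy) (by linarith)
      rw [div_lt_iff_of_neg (by linarith)]
      linarith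
    · linarith
  · have := hs.1 _ (hmem hx)
    linarith

theorem memN_Rpoly (n : ℕ) {q r : ℝ} (hr : 0 < r) (hrq : r < q) (hq1 : q ≤ 1) :
    memN n q (Rpoly n r) := by
  have hq0 := hr.trans hrq
  obtain ⟨hinj, hS⟩ := strictSep_image (n := n) (r := fun j => 1 / r ^ j) hq1
    (fun j => by positivity) (fun j _ => by
      rw [pow_succ, mul_one_div, div_lt_div_iff₀ (by positivity) (by positivity)]
      have : 0 < r ^ j := by positivity
      nlinarith)
  have e := prod_linear_eq (s := Finset.range n) (u := fun j => r ^ j) (p := fun _ => 1)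
    (fun j => by positivity) hinj
  rw [show Rpoly n r = _ from (Finset.prod_congr rfl fun j _ => by
    rw [C_1, add_comm]).trans e]
  exact memN_C_mul_rootProd hS (Finset.card_image_le.trans (Finset.card_range n).le)
    (Finset.prod_ne_zero_iff.2 fun j _ => by positivity)

theorem TendstoCoeff.comp {ι : Type*} {l : Filter ι} {n : ℕ} {P : ι → ℝ[X]} {P₀ : ℝ[X]}
    (h : TendstoCoeff n P l P₀) (a : ℝ) :
    TendstoCoeff n (fun i => (P i).comp (C a * X)) l (P₀.comp (C a * X)) := by
  have hdeg : ∀ R : ℝ[X], R.natDegree ≤ n → (R.comp (C a * X)).natDegree ≤ n := fun R hR =>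
    natDegree_le_iff_coeff_eq_zero.2 fun k hk => by
      rw [comp_C_mul_X_coeff, coeff_eq_zero_of_natDegree_lt (hR.trans_lt hk), zero_mul]
  refine ⟨fun i => hdeg _ (h.1 i), hdeg _ h.2.1, fun k => ?_⟩
  simp only [comp_C_mul_X_coeff]
  exact (h.2.2 k).mul_const _

theorem memN.lowerIm_comp {n : ℕ} {q : ℝ} (hq0 : 0 < q) {S : ℝ[X]} (hS : memN n q S) {ρ : ℝ}
    (hqρ : q ≤ ρ) (hρ : ρ < 1) : LowerIm S (S.comp (C ρ * X)) := by
  by_cases h0 : S = 0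
  · rw [h0, zero_comp]
    exact LowerIm.zero 0
  obtain ⟨c, r, s, -, -, hs, rfl⟩ := exists_strict_factorization (hqρ.trans hρ.le) hS h0
  obtain ⟨w, hw, e⟩ := exists_comp_eq hqρ hρ hs c r
  have hρ0 : 0 ≤ ρ := hq0.le.trans hqρ
  rw [e]
  refine (((LowerIm.self _).C_mul (pow_nonneg hρ0 _)).add
    (LowerIm.sum fun x hx => LowerIm.C_mul (hw x hx).le ?_)).C_mul (pow_nonneg hρ0 r)
  have := LowerIm.X_add_C_mul (C c * (X ^ r * rootProd (s.erase x))) x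
  rwa [mul_left_comm, mul_left_comm (X + C x), X_add_C_mul_rootProd_erase hx] at this

theorem logSep_of_lowerIm_comp {q : ℝ} {F : ℝ[X]}
    (hneg : OnlyNonposRoots F) (h : ∀ ρ, q ≤ ρ → ρ < 1 → LowerIm F (F.comp (C ρ * X))) :
    LogSep q F.roots := by
  by_cases hF0 : F = 0
  · simp [hF0, LogSep]
  have hroot : ∀ {y}, y ∈ F.roots → F.eval y = 0 := fun h => (mem_roots hF0).1 h
  have hor : ∀ y, F.eval y = 0 → ∀ ρ, q ≤ ρ → ρ < 1 →
      (derivative F).eval y ≠ 0 ∧ 0 ≤ (derivative F).eval y * F.eval (ρ * y) ∨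
        F.eval (ρ * y) = 0 := by
    intro y hy ρ h1 h2
    have := (h ρ h1 h2).deriv_mul_nonneg_or hF0 hy
    simpa only [eval_comp, eval_mul, eval_C, eval_X] using this
  have hsimple : q < 1 → ∀ y, F.eval y = 0 → y ≠ 0 → (derivative F).eval y ≠ 0 := by
    intro hq y hy hy0 hd
    refine hF0 (eq_zero_of_infinite_isRoot F
      (((Set.Ico_infinite hq).image (mul_left_injective₀ hy0).injOn).mono ?_))
    rintro _ ⟨ρ, hρ, rfl⟩
    exact (hor y hy ρ hρ.1 hρ.2).resolve_left fun h => h.1 hd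
  refine ⟨fun y hy hy0 h2 => ?_, fun x hx y hy hxy => ?_⟩
  · by_contra! hq
    rw [count_roots] at h2
    exact hsimple hq y (hroot hy) hy0 ((one_lt_rootMultiplicity_iff_isRoot hF0).1 h2).2
  · obtain ⟨hyx, hx0⟩ : y < x ∧ x < 0 :=
      hxy.resolve_right fun h => absurd (hneg x hx) (not_le.2 h.1)
    have hy0 : y < 0 := hyx.trans hx0
    by_contra! hgt
    have hlt : x / y < 1 := (div_lt_one_of_neg hy0).2 hyx
    have hq := hgt.trans hlt
    have hxy : x / y * y = x := div_mul_cancel₀ _ hy0.ne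
    have hmin : IsLocalMin (fun ρ => (derivative F).eval y * F.eval (ρ * y)) (x / y) := by
      filter_upwards [Ioo_mem_nhds hgt hlt] with ρ hρ
      rw [hxy, hroot hx, mul_zero]
      rcases hor y (hroot hy) ρ hρ.1.le hρ.2 with h | h
      · exact h.2
      · rw [h, mul_zero]
    have hder : HasDerivAt (fun ρ => (derivative F).eval y * F.eval (ρ * y))
        ((derivative F).eval y * ((derivative F).eval (x / y * y) * y)) (x / y) :=
      ((F.hasDerivAt (x / y * y)).comp (x / y) (hasDerivAt_mul_const y)).const_mul _
    have h0 := hmin.hasDerivAt_eq_zero hder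
    rw [hxy] at h0
    exact mul_ne_zero (hsimple hq y (hroot hy) hy0.ne)
      (mul_ne_zero (hsimple hq x (hroot hx) hx0.ne) hy0.ne) h0

theorem memNbar_of_forall_memN {n : ℕ} {q : ℝ} (hq0 : 0 < q) (hq1 : q ≤ 1) {F : ℝ[X]}
    (hF : F.natDegree ≤ n) (h : ∀ G : ℝ[X], memN n q G → memN n q (qHadamard n q F G)) :
    memNbar n q F := by
  have hev : ∀ᶠ r in nhdsWithin q (Set.Iio q), memN n q (qHadamard n q F (Rpoly n r)) := by
    filter_upwards [Ioo_mem_nhdsLT hq0] with r hr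
    exact h _ (memN_Rpoly n hr.1 hr.2 hq1)
  have hlim : TendstoCoeff n (fun r => qHadamard n q F (Rpoly n r)) (nhdsWithin q (Set.Iio q))
      F := by
    have := tendstoCoeff_qHadamard (n := n) (l := nhdsWithin q (Set.Iio q)) (P := fun _ => F)
      (Q := fun r => Rpoly n r) (Q₀ := Rpoly n q) hq0 tendsto_const_nhds
      (fun _ => tendsto_const_nhds)
      (fun k => ((continuous_qBinom n k).tendsto q).mono_left nhdsWithin_le_nhds)
    rwa [show qHadamard n q F (Rpoly n q) = F from ?_] at this
    ext k
    rw [qHadamard_coeff]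
    rcases le_or_gt k n with hk | hk
    · exact mul_div_cancel_right₀ _ (qBinom_pos hq0 hk).ne'
    · rw [coeff_eq_zero_of_natDegree_lt (hF.trans_lt hk), zero_mul, zero_div]
  have hmono := hlim.normMono (hev.mono fun r hr => NormMono.of_realRooted hr.1.2.1 hr.2)
  refine ⟨⟨hF, hmono.realRooted, logSep_of_lowerIm_comp hmono.onlyNonposRoots
    fun ρ h1 h2 => ?_⟩, hmono.onlyNonposRoots⟩
  exact hlim.lowerIm (hlim.comp ρ) (hev.mono fun r hr => hr.lowerIm_comp hq0 h1 h2)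

/-- `F *_q^n G ∈ 𝓝_n(q)` for every `G ∈ 𝓝_n(q)` iff `F ∈ 𝓝̄_n(q)`. -/
theorem stmt1 (n : ℕ) (hn : 1 ≤ n) (q : ℝ) (hq0 : 0 < q) (hq1 : q ≤ 1)
    (F : Polynomial ℝ) (hF : F.natDegree ≤ n) :
    (∀ G : Polynomial ℝ, memN n q G → memN n q (qHadamard n q F G)) ↔
      memNbar n q F := by
  exact ⟨memNbar_of_forall_memN hq0 hq1 hF, fun h G hG => memN_qHadamard hq0 hq1 h hG⟩
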